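/- For every infinite cardinal κ, the number of topological types of rooted trees of size κ is exactly κ⁺. Precisely: if V is a type of cardinality κ, then the quotient of the set of rooted trees with vertex set V by the equivalence relation ≡ (order-preserving mutual topological embeddability) has cardinality exactly κ⁺. -/

import Mathlib

universe u v

/-- A topological minor embedding of `H` into `G`: an injective map `toFun` on vertices
together with, for each edge of `H`, a path in `G` joining the images of its endpoints,
such that distinct edges get internally vertex-disjoint paths whose internal vertices
avoid the image of `toFun`. -/
structure TopMinorEmb {V : Type u} {W : Type v} (H : SimpleGraph V) (G : SimpleGraph W) where
  toFun : V → W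
  inj : Function.Injective toFun
  path : ∀ ⦃a b : V⦄, H.Adj a b → G.Walk (toFun a) (toFun b)
  path_isPath : ∀ ⦃a b : V⦄ (h : H.Adj a b), (path h).IsPath
  path_symm : ∀ ⦃a b : V⦄ (h : H.Adj a b), path h.symm = (path h).reverse
  internal_avoid_image : ∀ ⦃a b : V⦄ (h : H.Adj a b) (w : W),
      w ∈ (path h).support → w ≠ toFun a → w ≠ toFun b → ∀ x : V, toFun x ≠ w
  internally_disjoint : ∀ ⦃a b a' b' : V⦄ (h : H.Adj a b) (h' : H.Adj a' b'),
      s(a, b) ≠ s(a', b') → ∀ w : W,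
        w ∈ (path h).support → w ∈ (path h').support → w = toFun a ∨ w = toFun b

/-- `H ≤ G`: some subdivision of `H` embeds as a subgraph into `G`. -/
def TopMinorLE {V : Type u} {W : Type v} (H : SimpleGraph V) (G : SimpleGraph W) : Prop :=
  Nonempty (TopMinorEmb H G)

/-- `G ≡ H`: `G` and `H` have the same topological type. -/
def TopEquiv {V : Type u} {W : Type v} (G : SimpleGraph V) (H : SimpleGraph W) : Prop :=
  TopMinorLE G H ∧ TopMinorLE H G

/-- A rooted graph: a simple graph together with a distinguished root vertex. -/
structure RootedGraph (V : Type u) where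
  graph : SimpleGraph V
  root : V

/-- `treeLE G r t s` : the tree-order `t ≤_r s`, i.e. `t` lies on the
(for trees unique) path in `G` from the root `r` to `s`. -/
def treeLE {V : Type u} (G : SimpleGraph V) (r t s : V) : Prop :=
  ∃ w : G.Walk r s, w.IsPath ∧ t ∈ w.support

/-- `T ≤ S` for rooted graphs: a topological minor embedding of the underlying graphs
that preserves the tree-orders. -/
def RootedLE {V : Type u} {W : Type v} (T : RootedGraph V) (S : RootedGraph W) : Prop :=
  ∃ e : TopMinorEmb T.graph S.graph,
    ∀ x y : V, treeLE T.graph T.root x y → treeLE S.graph S.root (e.toFun x) (e.toFun y)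

/-- `T ≡ S` : rooted graphs of the same topological type. -/
def RootedEquiv {V : Type u} {W : Type v} (T : RootedGraph V) (S : RootedGraph W) : Prop :=
  RootedLE T S ∧ RootedLE S T

/-- The up-closure `{t' : t ≤_r t'}` of `t` (the `insert` is redundant for
connected graphs such as trees). -/
def upSet {V : Type u} (T : RootedGraph V) (t : V) : Set V :=
  insert t {s | treeLE T.graph T.root t s}

/-- The rooted subtree `⌈t⌉`: the subgraph induced on the up-closure of `t`, rooted at `t`. -/
def subtreeAt {V : Type u} (T : RootedGraph V) (t : V) : RootedGraph (upSet T t) :=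
  ⟨T.graph.induce (upSet T t), ⟨t, Set.mem_insert t _⟩⟩

/-- Rooted graphs bundled with their vertex type. -/
def RTreeSig := Σ V : Type u, RootedGraph V

def RTle (T S : RTreeSig.{u}) : Prop := RootedLE T.2 S.2

def RTequiv (T S : RTreeSig.{u}) : Prop := RTle T S ∧ RTle S T

def subtreeSig (T : RTreeSig.{u}) (t : T.1) : RTreeSig.{u} := ⟨upSet T.2 t, subtreeAt T.2 t⟩

/-! ### Locally constant functions on infinite sets of natural numbers -/

/-- `X` without its least element. -/
def tailSet (X : Set ℕ) : Set ℕ := X \ {sInf X}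

/-- `X` and `Y` have the same elements below `n`. -/
def AgreeBelow (n : ℕ) (X Y : Set ℕ) : Prop := ∀ k < n, k ∈ X ↔ k ∈ Y

/-- `f` is locally constant on the space of infinite subsets of `A`. -/
def LocConst {Q : Type*} (A : Set ℕ) (f : Set ℕ → Q) : Prop :=
  ∀ X ⊆ A, X.Infinite → ∃ n, ∀ Y ⊆ A, Y.Infinite → AgreeBelow n X Y → f Y = f X

theorem tailSet_subset (X : Set ℕ) : tailSet X ⊆ X := Set.sdiff_subset

theorem tailSet_infinite {X : Set ℕ} (h : X.Infinite) : (tailSet X).Infinite :=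
  h.sdiff (Set.finite_singleton _)

theorem AgreeBelow.mono {m n : ℕ} {X Y : Set ℕ} (h : AgreeBelow n X Y) (hmn : m ≤ n) :
    AgreeBelow m X Y := fun k hk => h k (hk.trans_le hmn)

theorem AgreeBelow.refl (n : ℕ) (X : Set ℕ) : AgreeBelow n X X := fun _ _ => Iff.rfl

theorem AgreeBelow.symm {n : ℕ} {X Y : Set ℕ} (h : AgreeBelow n X Y) : AgreeBelow n Y X :=
  fun k hk => (h k hk).symm

theorem AgreeBelow.trans {n : ℕ} {X Y Z : Set ℕ} (h : AgreeBelow n X Y) (h' : AgreeBelow n Y Z) :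
    AgreeBelow n X Z := fun k hk => (h k hk).trans (h' k hk)

theorem AgreeBelow.sInf_eq {n : ℕ} {X Y : Set ℕ} (h : AgreeBelow n X Y) (hX : X.Infinite)
    (hn : sInf X < n) : sInf Y = sInf X := by
  have h1 : sInf X ∈ Y := (h _ hn).1 (Nat.sInf_mem hX.nonempty)
  have h2 : sInf Y ≤ sInf X := Nat.sInf_le h1
  have h3 : sInf Y ∈ X := (h _ (h2.trans_lt hn)).2 (Nat.sInf_mem ⟨_, h1⟩)
  exact le_antisymm h2 (Nat.sInf_le h3)

theorem AgreeBelow.tailSet {n : ℕ} {X Y : Set ℕ} (h : AgreeBelow n X Y) (hX : X.Infinite)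
    (hn : sInf X < n) : AgreeBelow n (tailSet X) (tailSet Y) := by
  intro k hk
  simp only [_root_.tailSet, Set.mem_sdiff, Set.mem_singleton_iff, h.sInf_eq hX hn, h k hk]

section LocConst
variable {Q R S : Type*} {A B : Set ℕ} {f : Set ℕ → Q} {g : Set ℕ → R}

theorem LocConst.mono (h : LocConst A f) (hBA : B ⊆ A) : LocConst B f := by
  intro X hX hXi
  obtain ⟨n, hn⟩ := h X (hX.trans hBA) hXi
  exact ⟨n, fun Y hY => hn Y (hY.trans hBA)⟩

theorem LocConst.comp (h : LocConst A f) (F : Q → R) : LocConst A fun X => F (f X) := by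
  intro X hX hXi
  obtain ⟨n, hn⟩ := h X hX hXi
  exact ⟨n, fun Y hY hYi hXY => congrArg F (hn Y hY hYi hXY)⟩

theorem LocConst.comp₂ (h : LocConst A f) (h' : LocConst A g) (F : Q → R → S) :
    LocConst A fun X => F (f X) (g X) := by
  intro X hX hXi
  obtain ⟨n, hn⟩ := h X hX hXi
  obtain ⟨m, hm⟩ := h' X hX hXi
  refine ⟨max n m, fun Y hY hYi hXY => ?_⟩
  simp only [hn Y hY hYi (hXY.mono (le_max_left _ _)), hm Y hY hYi (hXY.mono (le_max_right _ _))]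

theorem LocConst.tail (h : LocConst A f) : LocConst A fun X => f (tailSet X) := by
  intro X hX hXi
  obtain ⟨n, hn⟩ := h (tailSet X) ((tailSet_subset X).trans hX) (tailSet_infinite hXi)
  refine ⟨max n (sInf X + 1), fun Y hY hYi hXY => hn _ ((tailSet_subset Y).trans hY)
    (tailSet_infinite hYi) ((hXY.tailSet hXi ?_).mono (le_max_left _ _))⟩
  exact lt_max_of_lt_right (Nat.lt_succ_self _)

theorem locConst_sInf (F : ℕ → Q) : LocConst A fun X => F (sInf X) := by
  intro X _ hXi
  exact ⟨sInf X + 1, fun Y _ _ hXY => congrArg F (hXY.sInf_eq hXi (Nat.lt_succ_self _))⟩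

end LocConst

/-! ### Fusion, the clopen Ramsey theorem, and minimal bad arrays -/

/-- `g` on the subsets of `B` lies pointwise below `f` on the subsets of `A`. -/
def ArrayBelow {Q : Type*} (le : Q → Q → Prop) (B : Set ℕ) (g : Set ℕ → Q)
    (A : Set ℕ) (f : Set ℕ → Q) : Prop :=
  B ⊆ A ∧ ∀ X ⊆ B, X.Infinite → le (g X) (f X)

section Fusion
variable {Q : Type*} {le : Q → Q → Prop}

theorem ArrayBelow.refl (hr : ∀ a, le a a) (A : Set ℕ) (f : Set ℕ → Q) :
    ArrayBelow le A f A f := ⟨subset_rfl, fun _ _ _ => hr _⟩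

theorem ArrayBelow.trans (ht : ∀ a b c, le a b → le b c → le a c) {A B C : Set ℕ}
    {f g h : Set ℕ → Q} (h₁ : ArrayBelow le C h B g) (h₂ : ArrayBelow le B g A f) :
    ArrayBelow le C h A f :=
  ⟨h₁.1.trans h₂.1, fun X hX hXi => ht _ _ _ (h₁.2 X hX hXi) (h₂.2 X (hX.trans h₁.1) hXi)⟩

/-- Data for one stage of a fusion argument. -/
structure FusionStage (Q : Type*) where
  point : ℕ
  dom : Set ℕ
  fn : Set ℕ → Q

theorem exists_fusion (hr : ∀ a, le a a) (ht : ∀ a b c, le a b → le b c → le a c)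
    {Inv : Set ℕ → (Set ℕ → Q) → Prop}
    (hsub : ∀ A B f, Inv A f → B ⊆ A → B.Infinite → Inv B f)
    (hinf : ∀ A f, Inv A f → A.Infinite)
    {Ψ : ℕ → Set ℕ → (Set ℕ → Q) → Prop} {k : ℕ} {A : Set ℕ} {f : Set ℕ → Q} (h₀ : Inv A f)
    (step : ∀ B g d, Inv B g → ArrayBelow le B g A f → AgreeBelow k B A → d ∈ B → k ≤ d →
      (∀ x ∈ B, x < d → x < k) →
      ∃ C h, Inv C h ∧ ArrayBelow le C h B g ∧ AgreeBelow (d + 1) C B ∧ Ψ d C h) :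
    ∃ (d : ℕ → ℕ) (C : ℕ → Set ℕ) (h : ℕ → Set ℕ → Q), StrictMono d ∧
      (∀ n, Inv (C n) (h n)) ∧ (∀ n, ArrayBelow le (C n) (h n) A f) ∧
      (∀ m n, m ≤ n → ArrayBelow le (C n) (h n) (C m) (h m)) ∧
      (∀ n, AgreeBelow k (C n) A) ∧ (∀ n, k ≤ d n) ∧ (∀ m n, m ≤ n → d n ∈ C m) ∧
      (∀ n, ∀ x ∈ C n, x < d n → x < k) ∧ ∀ n, Ψ (d n) (C n) (h n) := by
  classical
  let Ok : FusionStage Q → Prop := fun s =>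
    Inv s.dom s.fn ∧ ArrayBelow le s.dom s.fn A f ∧ AgreeBelow k s.dom A ∧ k ≤ s.point ∧
      s.point ∈ s.dom ∧ (∀ x ∈ s.dom, x < s.point → x < k) ∧ Ψ s.point s.dom s.fn
  have start : ∀ B g, Inv B g → ArrayBelow le B g A f → AgreeBelow k B A →
      ∃ s, Ok s ∧ ArrayBelow le s.dom s.fn B g ∧ s.point ∈ B := by
    intro B g hB hBA hag
    have hne : (B \ Set.Iio k).Nonempty :=
      ((hinf _ _ hB).sdiff (Set.finite_Iio k)).nonempty
    have hmem := Nat.sInf_mem hne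
    have hk : k ≤ sInf (B \ Set.Iio k) := by simpa using hmem.2
    have hmin : ∀ x ∈ B, x < sInf (B \ Set.Iio k) → x < k := by
      intro x hx hlt
      by_contra hge
      exact Nat.notMem_of_lt_sInf hlt ⟨hx, hge⟩
    obtain ⟨C, h, h1, h2, h3, h4⟩ := step B g _ hB hBA hag hmem.1 hk hmin
    refine ⟨⟨sInf (B \ Set.Iio k), C, h⟩, ⟨h1, h2.trans ht hBA,
      (h3.mono (hk.trans (Nat.le_succ _))).trans hag, hk, ?_, ?_, h4⟩, h2, hmem.1⟩
    · exact (h3 _ (Nat.lt_succ_self _)).2 hmem.1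
    · exact fun x hx => hmin x (h2.1 hx)
  have next : ∀ s : {s // Ok s}, ∃ t : {t // Ok t},
      ArrayBelow le t.1.dom t.1.fn s.1.dom s.1.fn ∧ s.1.point < t.1.point := by
    rintro ⟨s, h1, h2, h3, h4, h5, h6, h7⟩
    have hss : ArrayBelow le (s.dom \ {s.point}) s.fn s.dom s.fn :=
      ⟨Set.sdiff_subset, fun _ _ _ => hr _⟩
    obtain ⟨t, ht1, ht2, ht3⟩ := start (s.dom \ {s.point}) s.fn
      (hsub _ _ _ h1 Set.sdiff_subset ((hinf _ _ h1).sdiff (Set.finite_singleton _)))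
      (hss.trans ht h2) (by
        intro x hx
        rw [← h3 x hx, Set.mem_sdiff, Set.mem_singleton_iff]
        exact ⟨fun h => h.1, fun h => ⟨h, by omega⟩⟩)
    refine ⟨⟨t, ht1⟩, ht2.trans ht hss, ?_⟩
    rcases lt_trichotomy s.point t.point with h | h | h
    · exact h
    · exact absurd h.symm ht3.2
    · exact absurd (h6 _ ht3.1 h) (not_lt.2 ht1.2.2.2.1)
  obtain ⟨s₀, hs₀, -⟩ := start A f h₀ (ArrayBelow.refl hr A f) (AgreeBelow.refl _ _)
  choose nxt hnxt using next
  let q : ℕ → {s // Ok s} := fun n => Nat.rec ⟨s₀, hs₀⟩ (fun _ s => nxt s) n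
  have hq : ∀ n, ArrayBelow le (q (n + 1)).1.dom (q (n + 1)).1.fn (q n).1.dom (q n).1.fn ∧
      (q n).1.point < (q (n + 1)).1.point := fun n => hnxt (q n)
  have hmono : ∀ m n, m ≤ n →
      ArrayBelow le (q n).1.dom (q n).1.fn (q m).1.dom (q m).1.fn := by
    intro m n hmn
    induction n, hmn using Nat.le_induction with
    | base => exact ArrayBelow.refl hr _ _
    | succ n _ ih => exact (hq n).1.trans ht ih
  refine ⟨fun n => (q n).1.point, fun n => (q n).1.dom, fun n => (q n).1.fn,
    strictMono_nat_of_lt_succ fun n => (hq n).2, fun n => (q n).2.1, fun n => (q n).2.2.1, hmono,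
    fun n => (q n).2.2.2.1, fun n => (q n).2.2.2.2.1, ?_, fun n => (q n).2.2.2.2.2.2.1,
    fun n => (q n).2.2.2.2.2.2.2⟩
  exact fun m n hmn => (hmono m n hmn).1 (q n).2.2.2.2.2.1

/-- The limit of a sequence of sets whose initial parts stabilise. -/
theorem exists_limit_set {A : ℕ → Set ℕ} {k : ℕ → ℕ} (hanti : ∀ n, A (n + 1) ⊆ A n)
    (hk : ∀ n, k n < k (n + 1)) (hag : ∀ n, AgreeBelow (k n) (A (n + 1)) (A n))
    (hnew : ∀ n, ∃ d ∈ A (n + 1), k n ≤ d ∧ d < k (n + 1)) :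
    ∃ X : Set ℕ, X.Infinite ∧ ∀ n, X ⊆ A n ∧ AgreeBelow (k n) X (A n) := by
  have hkm : StrictMono k := strictMono_nat_of_lt_succ hk
  have hA : ∀ m n, m ≤ n → A n ⊆ A m := fun m n hmn => antitone_nat_of_succ_le hanti hmn
  have hag' : ∀ m n, m ≤ n → AgreeBelow (k m) (A n) (A m) := by
    intro m n hmn
    induction n, hmn using Nat.le_induction with
    | base => exact AgreeBelow.refl _ _
    | succ n hn ih => exact ((hag n).mono (hkm.monotone hn)).trans ih
  have hagree : ∀ n, AgreeBelow (k n) (⋂ m, A m) (A n) := by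
    intro n x hx
    refine ⟨fun h => Set.mem_iInter.1 h n, fun h => Set.mem_iInter.2 fun m => ?_⟩
    rcases le_total n m with hnm | hmn
    · exact (hag' n m hnm x hx).2 h
    · exact hA m n hmn h
  refine ⟨⋂ m, A m, ?_, fun n => ⟨Set.iInter_subset _ n, hagree n⟩⟩
  refine Set.infinite_of_not_bddAbove fun ⟨b, hb⟩ => ?_
  obtain ⟨d, hd, hd1, hd2⟩ := hnew (b + 1)
  have h1 := hb ((hagree _ d hd2).2 hd)
  have h2 := hkm.id_le (b + 1)
  simp only [id_eq] at h2
  omega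

/-- The clopen Ramsey theorem of Nash-Williams. -/
theorem exists_homogeneous {A : Set ℕ} (hA : A.Infinite) {P : Set ℕ → Prop} (hP : LocConst A P) :
    ∃ B ⊆ A, B.Infinite ∧
      ((∀ X ⊆ B, X.Infinite → P X) ∨ ∀ X ⊆ B, X.Infinite → ¬ P X) := by
  classical
  let Hom : ℕ → Set ℕ → Prop → Prop := fun k B c =>
    ∀ X ⊆ B, X.Infinite → AgreeBelow k X B → (P X ↔ c)
  let Hopeless : ℕ → Set ℕ → Prop := fun k B =>
    ∀ C ⊆ B, C.Infinite → AgreeBelow k C B → ∀ c, ¬ Hom k C c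
  have step : ∀ k B, B.Infinite → Hopeless k B →
      ∃ C d, C ⊆ B ∧ C.Infinite ∧ AgreeBelow k C B ∧ d ∈ C ∧ k ≤ d ∧ Hopeless (d + 1) C := by
    intro k B hB hk
    by_contra! hcon
    obtain ⟨d, C, _, hd, hCi, hCB, hCC, hag, hkd, hdC, hlow, hΨ⟩ :=
      exists_fusion (Q := Unit) (le := fun _ _ => True) (fun _ => trivial)
        (fun _ _ _ _ _ => trivial) (Inv := fun A _ => A.Infinite) (fun _ _ _ _ _ h => h)
        (fun _ _ h => h) (Ψ := fun d C _ => ∃ c, Hom (d + 1) C c) (k := k) (A := B)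
        (f := fun _ => ()) hB (by
          intro D g d hD hDB hag hdD hkd _
          have := hcon D d hDB.1 hD hag hdD hkd
          simp only [Hopeless] at this
          push Not at this
          obtain ⟨C, h1, h2, h3, h4⟩ := this
          exact ⟨C, g, h2, ⟨h1, fun _ _ _ => trivial⟩, h3, h4⟩)
    choose c hc using hΨ
    have hinf : ∃ b : Prop, {n | c n = b}.Infinite := by
      by_contra! hfin
      refine Set.infinite_univ (α := ℕ) (((hfin True).union (hfin False)).subset fun n _ => ?_)
      by_cases h : c n
      · exact Or.inl (eq_true h)
      · exact Or.inr (eq_false h)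
    obtain ⟨b, hb⟩ := hinf
    refine hk ((B ∩ Set.Iio k) ∪ d '' {n | c n = b}) ?_ ?_ ?_ b ?_
    · rintro x (hx | ⟨n, -, rfl⟩)
      · exact hx.1
      · exact (hCB n).1 (hdC n n le_rfl)
    · exact (hb.image hd.injective.injOn).mono Set.subset_union_right
    · intro x hx
      constructor
      · rintro (h | ⟨n, -, rfl⟩)
        · exact h.1
        · exact absurd (hkd n) (not_le.2 hx)
      · exact fun h => Or.inl ⟨h, hx⟩
    · intro X hX hXi hXag
      have hex : ∃ n, d n ∈ X := by
        obtain ⟨x, hx, hxk⟩ := hXi.exists_gt k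
        rcases hX hx with h | ⟨n, -, rfl⟩
        · exact absurd hxk (not_lt.2 (le_of_lt h.2))
        · exact ⟨n, hx⟩
      have hn := Nat.find_spec hex
      have hmin : ∀ m, d m ∈ X → Nat.find hex ≤ m := fun m hm => Nat.find_min' hex hm
      set n := Nat.find hex
      have hcn : c n = b := by
        rcases hX hn with h | ⟨m, hm, hmn⟩
        · exact absurd h.2 (not_lt.2 (hkd n))
        · rwa [← hd.injective hmn]
      have hsub : X ⊆ C n := by
        intro x hx
        rcases hX hx with h | ⟨m, -, rfl⟩
        · exact (hag n x h.2).2 h.1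
        · exact hdC n m (hmin m hx)
      have hagX : AgreeBelow (d n + 1) X (C n) := by
        intro x hx
        refine ⟨fun h => hsub h, fun h => ?_⟩
        rcases (Nat.lt_succ_iff.1 hx).lt_or_eq with h1 | rfl
        · have hxk := hlow n x h h1
          exact (hXag x hxk).2 (Or.inl ⟨(hag n x hxk).1 h, hxk⟩)
        · exact hn
      rw [← hcn]
      exact hc n X hsub hXi hagX
  by_contra! hcon
  have h0 : Hopeless 0 A := by
    intro C hC hCi _ c hc
    obtain ⟨⟨X, hX, hXi, hPX⟩, Y, hY, hYi, hPY⟩ := hcon C hC hCi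
    exact hPX ((hc X hX hXi (by intro k hk; omega)).2
      ((hc Y hY hYi (by intro k hk; omega)).1 hPY))
  let St := {p : ℕ × Set ℕ // p.2 ⊆ A ∧ p.2.Infinite ∧ Hopeless p.1 p.2}
  have next : ∀ p : St, ∃ q : St, q.1.2 ⊆ p.1.2 ∧ p.1.1 < q.1.1 ∧
      AgreeBelow p.1.1 q.1.2 p.1.2 ∧ ∃ d ∈ q.1.2, p.1.1 ≤ d ∧ d < q.1.1 := by
    rintro ⟨⟨k, B⟩, hBA, hB, hk⟩
    obtain ⟨C, d, h1, h2, h3, h4, h5, h6⟩ := step k B hB hk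
    exact ⟨⟨⟨d + 1, C⟩, h1.trans hBA, h2, h6⟩, h1, by simp only; omega, h3, d, h4, h5,
      Nat.lt_succ_self _⟩
  choose nxt hnxt using next
  let q : ℕ → St := fun n => Nat.rec ⟨(0, A), subset_rfl, hA, h0⟩ (fun _ s => nxt s) n
  have hq : ∀ n, q (n + 1) = nxt (q n) := fun n => rfl
  obtain ⟨X, hXi, hX⟩ := exists_limit_set (A := fun n => (q n).1.2) (k := fun n => (q n).1.1)
    (fun n => (hnxt (q n)).1) (fun n => (hnxt (q n)).2.1) (fun n => (hnxt (q n)).2.2.1)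
    (fun n => (hnxt (q n)).2.2.2)
  obtain ⟨n, hn⟩ := hP X (hX 0).1 hXi
  have hkn : n ≤ (q n).1.1 :=
    (strictMono_nat_of_lt_succ (f := fun n => (q n).1.1) fun n => (hnxt (q n)).2.1).id_le n
  refine (q n).2.2.2 (q n).1.2 subset_rfl (q n).2.2.1 (AgreeBelow.refl _ _) (P X) ?_
  intro Y hY hYi hag
  rw [hn Y (hY.trans (q n).2.1) hYi (((hX n).2.trans hag.symm).mono hkn)]

end Fusion

/-- A bad array: a locally constant map on the infinite subsets of `A` that never increases
when the least element of the argument is removed. -/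
structure Bad {Q : Type*} (r : Q → Q → Prop) (A : Set ℕ) (f : Set ℕ → Q) : Prop where
  infinite : A.Infinite
  locConst : LocConst A f
  not_rel : ∀ X ⊆ A, X.Infinite → ¬ r (f X) (f (tailSet X))

section Bad
variable {Q : Type*} {r : Q → Q → Prop}

theorem Bad.mono {A B : Set ℕ} {f : Set ℕ → Q} (h : Bad r A f) (hBA : B ⊆ A)
    (hB : B.Infinite) : Bad r B f :=
  ⟨hB, h.locConst.mono hBA, fun X hX => h.not_rel X (hX.trans hBA)⟩

theorem exists_perfect_or_bad (r : Q → Q → Prop) {A : Set ℕ} {f : Set ℕ → Q} (hA : A.Infinite)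
    (hf : LocConst A f) :
    ∃ B ⊆ A, B.Infinite ∧
      ((∀ X ⊆ B, X.Infinite → r (f X) (f (tailSet X))) ∨ Bad r B f) := by
  obtain ⟨B, hB, hBi, h⟩ := exists_homogeneous hA (hf.comp₂ hf.tail r)
  exact ⟨B, hB, hBi, h.imp_right fun h => ⟨hBi, hf.mono hB, h⟩⟩

/-- Every bad array lies above a minimal bad array. -/
theorem Bad.exists_minimal {lt : Q → Q → Prop} (htr : ∀ a b c, r a b → r b c → r a c)
    (hlt : ∀ a b c, lt a b → lt b c → lt a c) (hltr : ∀ a b, lt a b → r a b)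
    {A : Set ℕ} {f : Set ℕ → Q} (hf : Bad r A f)
    (hacc : ∀ X ⊆ A, X.Infinite → Acc lt (f X)) :
    ∃ B g, Bad r B g ∧ ArrayBelow (fun a b => lt a b ∨ a = b) B g A f ∧
      ∀ C h, Bad r C h → ¬ ArrayBelow lt C h B g := by
  classical
  set le : Q → Q → Prop := fun a b => lt a b ∨ a = b with hle
  have ler : ∀ a, le a a := fun a => Or.inr rfl
  have let' : ∀ a b c, le a b → le b c → le a c := by
    rintro a b c (h | rfl) (h' | rfl)
    · exact Or.inl (hlt _ _ _ h h')
    · exact Or.inl h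
    · exact Or.inl h'
    · exact Or.inr rfl
  have ltle : ∀ a b c, lt a b → le b c → lt a c := by
    rintro a b c h (h' | rfl)
    · exact hlt _ _ _ h h'
    · exact h
  let Red : ℕ → Set ℕ → (Set ℕ → Q) → Prop := fun k B g =>
    ∃ C h, Bad r C h ∧ ArrayBelow lt C h B g ∧ AgreeBelow k C B
  let DRed : ℕ → Set ℕ → (Set ℕ → Q) → Prop := fun k B g =>
    ∀ C h, Bad r C h → ArrayBelow le C h B g → AgreeBelow k C B → Red k C h
  have step : ∀ k B g, Bad r B g → DRed k B g →
      ∃ C h d, Bad r C h ∧ ArrayBelow le C h B g ∧ AgreeBelow k C B ∧ d ∈ C ∧ k ≤ d ∧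
        DRed (d + 1) C h := by
    intro k B g hB hk
    by_contra! hcon
    obtain ⟨d, C, h, hd, hbad, hCB, hCC, hag, hkd, hdC, hlow, hΨ⟩ :=
      exists_fusion ler let' (Inv := Bad r) (fun _ _ _ h h1 h2 => h.mono h1 h2)
        (fun _ _ h => h.infinite) (Ψ := fun d C h => ¬ Red (d + 1) C h) (k := k) (A := B)
        (f := g) hB (by
          intro D g d hD hDB hag hdD hkd _
          have := hcon D g d hD hDB hag hdD hkd
          simp only [DRed] at this
          push Not at this
          obtain ⟨C, h, h1, h2, h3, h4⟩ := this
          exact ⟨C, h, h1, h2, h3, h4⟩)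
    let D : Set ℕ := (B ∩ Set.Iio k) ∪ Set.range d
    have hex : ∀ X ⊆ D, X.Infinite → ∃ n, d n ∈ X := by
      intro X hX hXi
      obtain ⟨x, hx, hxk⟩ := hXi.exists_gt k
      rcases hX hx with h | ⟨n, rfl⟩
      · exact absurd hxk (not_lt.2 (le_of_lt h.2))
      · exact ⟨n, hx⟩
    let ν : Set ℕ → ℕ := fun X => sInf {n | d n ∈ X}
    have hν : ∀ X ⊆ D, X.Infinite → d (ν X) ∈ X := fun X hX hXi => Nat.sInf_mem (hex X hX hXi)
    have hνle : ∀ X n, d n ∈ X → ν X ≤ n := fun X n hn => Nat.sInf_le hn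
    have hsub : ∀ X ⊆ D, X ⊆ C (ν X) := by
      intro X hX x hx
      rcases hX hx with h | ⟨m, rfl⟩
      · exact (hag _ x h.2).2 h.1
      · exact hdC _ m (hνle X m hx)
    have hDi : D.Infinite := (Set.infinite_range_of_injective hd.injective).mono
      Set.subset_union_right
    have hDB : D ⊆ B := by
      rintro x (hx | ⟨n, rfl⟩)
      · exact hx.1
      · exact (hCB n).1 (hdC n n le_rfl)
    have hDbad : Bad r D (fun X => h (ν X) X) := by
      refine ⟨hDi, ?_, ?_⟩
      · intro X hX hXi
        obtain ⟨n, hn⟩ := (hbad (ν X)).locConst X (hsub X hX) hXi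
        refine ⟨max n (d (ν X) + 1), fun Y hY hYi hXY => ?_⟩
        have h1 : d (ν X) ∈ Y := (hXY _ (lt_max_of_lt_right (Nat.lt_succ_self _))).1 (hν X hX hXi)
        have h2 : ν Y ≤ ν X := hνle Y _ h1
        have h3 : ν X ≤ ν Y := hνle X _ ((hXY _ (lt_max_of_lt_right
          (Nat.lt_succ_of_le (hd.monotone h2)))).2 (hν Y hY hYi))
        have h4 : ν Y = ν X := le_antisymm h2 h3
        have h5 := hsub Y hY
        simp only [h4] at h5 ⊢
        exact hn Y h5 hYi (hXY.mono (le_max_left _ _))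
      · intro X hX hXi hr
        have htX := (tailSet_subset X).trans hX
        have hti := tailSet_infinite hXi
        have h1 : ν X ≤ ν (tailSet X) := hνle X _ (tailSet_subset X (hν _ htX hti))
        have h2 := (hCC _ _ h1).2 (tailSet X) (hsub _ htX) hti
        refine (hbad (ν X)).not_rel X (hsub X hX) hXi ?_
        rcases h2 with h2 | h2
        · exact htr _ _ _ hr (hltr _ _ h2)
        · rw [← h2]; exact hr
    have hDag : AgreeBelow k D B := by
      intro x hx
      constructor
      · exact fun h => hDB h
      · exact fun h => Or.inl ⟨h, hx⟩
    obtain ⟨E, e, hE, hED, hEag⟩ := hk D _ hDbad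
      ⟨hDB, fun X hX hXi => (hCB _).2 X (hsub X hX) hXi⟩ hDag
    have hEC := hsub E hED.1
    refine hΨ (ν E) ⟨E, e, hE, ⟨hEC, fun X hX hXi => ?_⟩, ?_⟩
    · have h1 : ν E ≤ ν X := hνle E _ (hX (hν X (hX.trans hED.1) hXi))
      exact ltle _ _ _ (hED.2 X hX hXi) ((hCC _ _ h1).2 X (hsub X (hX.trans hED.1)) hXi)
    · intro x hx
      refine ⟨fun h => hEC h, fun h => ?_⟩
      rcases (Nat.lt_succ_iff.1 hx).lt_or_eq with h1 | rfl
      · have hxk := hlow _ x h h1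
        exact (hEag x hxk).2 (Or.inl ⟨(hag _ x hxk).1 h, hxk⟩)
      · exact hν E hED.1 hE.infinite
  by_contra! hcon
  have h0 : DRed 0 A f := by
    intro C h hC hCA _
    obtain ⟨E, e, hE, hEC⟩ := hcon C h hC hCA
    exact ⟨E, e, hE, hEC, by intro k hk; omega⟩
  let St := {p : ℕ × Set ℕ × (Set ℕ → Q) // Bad r p.2.1 p.2.2 ∧ DRed p.1 p.2.1 p.2.2}
  have next : ∀ p : St, ∃ q : St, ArrayBelow lt q.1.2.1 q.1.2.2 p.1.2.1 p.1.2.2 ∧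
      p.1.1 < q.1.1 ∧ AgreeBelow p.1.1 q.1.2.1 p.1.2.1 ∧
      ∃ d ∈ q.1.2.1, p.1.1 ≤ d ∧ d < q.1.1 := by
    rintro ⟨⟨k, B, g⟩, hB, hk⟩
    obtain ⟨B', g', h1, h2, h3⟩ := hk B g hB (ArrayBelow.refl ler _ _) (AgreeBelow.refl _ _)
    have hk' : DRed k B' g' := fun C h hC hCB hag => hk C h hC
      (hCB.trans let' ⟨h2.1, fun X hX hXi => Or.inl (h2.2 X hX hXi)⟩) (hag.trans h3)
    obtain ⟨C, h, d, h4, h5, h6, h7, h8, h9⟩ := step k B' g' h1 hk'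
    refine ⟨⟨⟨d + 1, C, h⟩, h4, h9⟩, ⟨h5.1.trans h2.1, fun X hX hXi => ?_⟩, by simp only; omega,
      h6.trans h3, d, h7, h8, Nat.lt_succ_self _⟩
    rcases h5.2 X hX hXi with h | h
    · exact hlt _ _ _ h (h2.2 X (hX.trans h5.1) hXi)
    · simp only [h]
      exact h2.2 X (hX.trans h5.1) hXi
  choose nxt hnxt using next
  let q : ℕ → St := fun n => Nat.rec ⟨(0, A, f), hf, h0⟩ (fun _ s => nxt s) n
  obtain ⟨X, hXi, hX⟩ := exists_limit_set (A := fun n => (q n).1.2.1) (k := fun n => (q n).1.1)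
    (fun n => (hnxt (q n)).1.1) (fun n => (hnxt (q n)).2.1) (fun n => (hnxt (q n)).2.2.1)
    (fun n => (hnxt (q n)).2.2.2)
  have hdesc : ∀ n, lt ((q (n + 1)).1.2.2 X) ((q n).1.2.2 X) := fun n =>
    (hnxt (q n)).1.2 X (hX (n + 1)).1 hXi
  have : ∀ a, Acc lt a → ∀ n, (q n).1.2.2 X ≠ a := by
    intro a ha
    induction ha with
    | intro a _ ih => rintro n rfl; exact ih _ (hdesc n) (n + 1) rfl
  exact this _ (hacc X (hX 0).1 hXi) 0 rfl

end Bad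

section Traces

/-- The Hoare quasi-order on sets. -/
def HoareLE {Q : Type*} (r : Q → Q → Prop) (S T : Set Q) : Prop := ∀ a ∈ S, ∃ b ∈ T, r a b

variable {Q : Type*} {r : Q → Q → Prop}

theorem Bad.exists_mem_of_hoareLE {A : Set ℕ} {S : Set ℕ → Set Q} (hS : Bad (HoareLE r) A S) :
    ∃ c, Bad r A c ∧ ∀ X ⊆ A, X.Infinite → c X ∈ S X := by
  classical
  have key : ∀ X ⊆ A, X.Infinite → ∃ a ∈ S X, ∀ b ∈ S (tailSet X), ¬ r a b := by
    intro X hX hXi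
    have := hS.not_rel X hX hXi
    unfold HoareLE at this
    push Not at this
    exact this
  obtain ⟨q, -⟩ := key A subset_rfl hS.infinite
  have : Nonempty Q := ⟨q⟩
  let F : Set Q → Set Q → Q := fun U W => Classical.epsilon fun a => a ∈ U ∧ ∀ b ∈ W, ¬ r a b
  have hF : ∀ X ⊆ A, X.Infinite → F (S X) (S (tailSet X)) ∈ S X ∧
      ∀ b ∈ S (tailSet X), ¬ r (F (S X) (S (tailSet X))) b :=
    fun X hX hXi => Classical.epsilon_spec (key X hX hXi)
  refine ⟨fun X => F (S X) (S (tailSet X)),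
    ⟨hS.infinite, hS.locConst.comp₂ hS.locConst.tail F, fun X hX hXi => ?_⟩,
    fun X hX hXi => (hF X hX hXi).1⟩
  exact (hF X hX hXi).2 _
    (hF _ ((tailSet_subset X).trans hX) (tailSet_infinite hXi)).1

theorem acc_properSuffix (l : List Q) : Acc (fun a b : List Q => a <:+ b ∧ a ≠ b) l := by
  refine Subrelation.accessible ?_
    (InvImage.accessible List.length (Nat.lt_wfRel.wf.apply l.length))
  intro a b h
  exact lt_of_le_of_ne h.1.length_le fun he => h.2 (h.1.eq_of_length he)

theorem Bad.exists_mem_of_list (hr : ∀ a, r a a) (ht : ∀ a b c, r a b → r b c → r a c)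
    {A : Set ℕ} {F : Set ℕ → List Q} (hF : Bad (List.SublistForall₂ r) A F) :
    ∃ B ⊆ A, ∃ c, Bad r B c ∧ ∀ X ⊆ B, X.Infinite → c X ∈ F X := by
  have : Std.Refl r := ⟨hr⟩
  have : IsTrans Q r := ⟨ht⟩
  obtain ⟨B, g, hg, hgF, hmin⟩ := Bad.exists_minimal (r := List.SublistForall₂ r)
    (lt := fun a b : List Q => a <:+ b ∧ a ≠ b)
    (fun a b c h h' => _root_.trans h h')
    (fun a b c h h' => ⟨h.1.trans h'.1, fun e => h'.2 (h'.1.eq_of_length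
      (le_antisymm h'.1.length_le (e ▸ h.1.length_le)))⟩)
    (fun a b h => List.sublistForall₂_iff.2 ⟨a, List.forall₂_refl _, h.1.sublist⟩)
    hF (fun X _ _ => acc_properSuffix _)
  have hne : ∀ X ⊆ B, X.Infinite → ∃ h t, g X = h :: t := by
    intro X hX hXi
    cases hgX : g X with
    | nil => exact absurd (hgX ▸ List.SublistForall₂.nil) (hg.not_rel X hX hXi)
    | cons h t => exact ⟨h, t, rfl⟩
  obtain ⟨q, -⟩ := hne B subset_rfl hg.infinite
  obtain ⟨B₁, hB₁, hB₁i, hh⟩ :=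
    exists_perfect_or_bad r hg.infinite (hg.locConst.comp fun l => l.headD q)
  rcases hh with hh | hh
  · exfalso
    obtain ⟨B₂, hB₂, hB₂i, htl⟩ := exists_perfect_or_bad (List.SublistForall₂ r) hB₁i
      ((hg.locConst.comp List.tail).mono hB₁)
    rcases htl with htl | htl
    · have hB := hB₂.trans hB₁
      obtain ⟨h, t, e⟩ := hne B₂ hB hB₂i
      obtain ⟨h', t', e'⟩ :=
        hne (tailSet B₂) ((tailSet_subset _).trans hB) (tailSet_infinite hB₂i)
      have h1 := hh B₂ hB₂ hB₂i
      have h2 := htl B₂ subset_rfl hB₂i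
      simp only [e, e', List.headD_cons, List.tail_cons] at h1 h2
      exact hg.not_rel B₂ hB hB₂i (by rw [e, e']; exact .cons h1 h2)
    · refine hmin B₂ _ htl ⟨hB₂.trans hB₁, fun X hX hXi => ⟨List.tail_suffix _, ?_⟩⟩
      obtain ⟨h, t, e⟩ := hne X ((hX.trans hB₂).trans hB₁) hXi
      simp [e]
  · refine ⟨B₁, hB₁.trans hgF.1, _, hh, fun X hX hXi => ?_⟩
    have hsuf : g X <:+ F X := by
      rcases hgF.2 X (hX.trans hB₁) hXi with h | h
      · exact h.1
      · rw [h]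
    obtain ⟨h, t, e⟩ := hne X (hX.trans hB₁) hXi
    refine hsuf.subset ?_
    simp [e]

/-- There is no bad array of elements of a well-order. -/
theorem not_bad_le_of_wellFoundedLT {α : Type*} [LinearOrder α] [WellFoundedLT α] {A : Set ℕ}
    {f : Set ℕ → α} : ¬ Bad (· ≤ ·) A f := by
  intro h
  have key : ∀ a : α, ∀ X ⊆ A, X.Infinite → f X = a → False := by
    intro a
    induction a using WellFoundedLT.induction with
    | ind a ih =>
      intro X hX hXi e
      refine ih (f (tailSet X)) ?_ _ ((tailSet_subset X).trans hX) (tailSet_infinite hXi) rfl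
      exact e ▸ not_le.1 (h.not_rel X hX hXi)
  exact key _ A subset_rfl h.infinite rfl

/-- A bad array of pairs whose second components are well-ordered yields a bad array of first
components. -/
theorem Bad.fst_of_wellFoundedLT {α : Type*} [LinearOrder α] [WellFoundedLT α] {A : Set ℕ}
    {f : Set ℕ → Q × α} (h : Bad (fun a b => r a.1 b.1 ∧ a.2 ≤ b.2) A f) :
    ∃ B ⊆ A, Bad r B fun X => (f X).1 := by
  obtain ⟨B, hB, hBi, h2⟩ :=
    exists_perfect_or_bad (· ≤ ·) h.infinite (h.locConst.comp Prod.snd)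
  have h2 := h2.resolve_right not_bad_le_of_wellFoundedLT
  exact ⟨B, hB, hBi, (h.locConst.comp Prod.fst).mono hB, fun X hX hXi hr =>
    h.not_rel X (hX.trans hB) hXi ⟨hr, h2 X hX hXi⟩⟩

end Traces

section Injection
open Cardinal

theorem exists_index_of_fibers_le {I : Type u} (κ : I → Cardinal.{u})
    (heq : ∀ i, #{i' // κ i' = κ i} ≤ κ i) :
    ∃ idx : I → Ordinal.{u}, (∀ i i', κ i' = κ i → idx i' = idx i → i' = i) ∧
      ∀ i, #{i' // κ i' = κ i ∧ idx i' < idx i} < κ i := by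
  have hfib : ∀ c : Cardinal.{u}, ∃ ι : {i // κ i = c} → c.ord.ToType, Function.Injective ι := by
    intro c
    by_cases hc : ∃ i, κ i = c
    · obtain ⟨i, rfl⟩ := hc
      have := heq i
      obtain ⟨f⟩ := (Cardinal.le_def _ _).1 (this.trans (Cardinal.mk_ord_toType (κ i)).ge)
      exact ⟨f, f.injective⟩
    · exact ⟨fun i => (hc ⟨i.1, i.2⟩).elim, fun i => (hc ⟨i.1, i.2⟩).elim⟩
  choose ι hι using hfib
  let J : ∀ c : Cardinal.{u}, c.ord.ToType → Ordinal.{u} := fun c x => (Ordinal.ToType.mk.symm x).1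
  have hJ : ∀ c, StrictMono (J c) := fun c x y h => Ordinal.ToType.mk.symm.strictMono h
  have hidx : ∀ c i (h : κ i = c), J _ (ι (κ i) ⟨i, rfl⟩) = J _ (ι c ⟨i, h⟩) := by
    rintro _ i rfl
    rfl
  refine ⟨fun i => J _ (ι (κ i) ⟨i, rfl⟩), fun i i' h h' => ?_, fun i => ?_⟩
  · beta_reduce at h'
    rw [hidx _ i' h] at h'
    simpa using hι _ ((hJ _).injective h')
  · have h1 : #(Set.Iio (ι (κ i) ⟨i, rfl⟩)) < κ i := by
      simpa using Cardinal.mk_Iio_lt (ι (κ i) ⟨i, rfl⟩)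
    refine lt_of_le_of_lt ?_ h1
    refine Cardinal.mk_le_of_injective (f := fun i' => ⟨ι (κ i) ⟨i'.1, i'.2.1⟩, ?_⟩) ?_
    · have := i'.2.2
      beta_reduce at this
      rw [hidx _ i'.1 i'.2.1] at this
      exact (hJ _).lt_iff_lt.1 this
    · intro a b hab
      have := hι _ (congrArg Subtype.val hab)
      exact Subtype.ext (by simpa using this)

/-- Greedy choice of distinct representatives. -/
theorem exists_injective_avoiding {I J : Type u} (R : I → J → Prop) (κ : I → Cardinal.{u})
    (hκ : ∀ i, ℵ₀ ≤ κ i) (hR : ∀ i, κ i ≤ #{j // R i j})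
    (hlt : ∀ i, #{i' // κ i' < κ i} < κ i) (heq : ∀ i, #{i' // κ i' = κ i} ≤ κ i)
    {t : Set J} (ht : t.Finite) :
    ∃ e : I → J, Function.Injective e ∧ ∀ i, R i (e i) ∧ e i ∉ t := by
  classical
  obtain ⟨idx, hinj, hidx⟩ := exists_index_of_fibers_le κ heq
  let rel : I → I → Prop := fun i i' => κ i < κ i' ∨ κ i = κ i' ∧ idx i < idx i'
  have hwf : WellFounded rel := by
    refine Subrelation.wf ?_ (InvImage.wf (fun i => (κ i, idx i)) (WellFounded.prod_lex
      (wellFounded_lt (α := Cardinal.{u})) (wellFounded_lt (α := Ordinal.{u}))))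
    intro i i' h
    exact Prod.lex_def.2 h
  have htot : ∀ i i', i ≠ i' → rel i i' ∨ rel i' i := by
    intro i i' hne
    rcases lt_trichotomy (κ i) (κ i') with h | h | h
    · exact Or.inl (Or.inl h)
    · rcases lt_trichotomy (idx i) (idx i') with h' | h' | h'
      · exact Or.inl (Or.inr ⟨h, h'⟩)
      · exact absurd (hinj _ _ h h') hne
      · exact Or.inr (Or.inr ⟨h.symm, h'⟩)
    · exact Or.inr (Or.inl h)
  have hcard : ∀ i, #{i' // rel i' i} < κ i := fun i =>
    (mk_union_le {i' | κ i' < κ i} {i' | κ i' = κ i ∧ idx i' < idx i}).trans_lt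
      (add_lt_of_lt (hκ i) (hlt i) (hidx i))
  have hex : ∀ i (f : ∀ i', rel i' i → J), ∃ j, R i j ∧ j ∉ t ∧ ∀ i' h, j ≠ f i' h := by
    intro i f
    by_contra! hcon
    have hsub : {j | R i j} ⊆ t ∪ Set.range fun i' : {i' // rel i' i} => f i'.1 i'.2 := by
      intro j hj
      by_cases hjt : j ∈ t
      · exact Or.inl hjt
      · obtain ⟨i', h, rfl⟩ := hcon j hj hjt
        exact Or.inr ⟨⟨i', h⟩, rfl⟩
    refine ((hR i).trans ((mk_le_mk_of_subset hsub).trans (mk_union_le _ _))).not_gt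
      (add_lt_of_lt (hκ i) ?_ (mk_range_le.trans_lt (hcard i)))
    exact (lt_aleph0_iff_set_finite.2 ht).trans_le (hκ i)
  choose pick hp using hex
  let e : I → J := hwf.fix pick
  have he : ∀ i, e i = pick i fun i' _ => e i' := fun i => hwf.fix_eq pick i
  have hne : ∀ i i', rel i' i → e i ≠ e i' := by
    intro i i' h
    rw [he i]
    exact (hp i _).2.2 i' h
  refine ⟨e, fun i i' h => ?_, fun i => ?_⟩
  · by_contra hii
    rcases htot i i' hii with h' | h'
    · exact hne _ _ h' h.symm
    · exact hne _ _ h' h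
  · rw [he i]
    exact ⟨(hp i _).1, (hp i _).2.1⟩

end Injection

section Basis
variable {Q : Type*} {r : Q → Q → Prop}

theorem WellQuasiOrdered.exists_finite_basis (h : WellQuasiOrdered r) (S : Set Q) :
    ∃ B ⊆ S, B.Finite ∧ ∀ a ∈ S, ∃ b ∈ B, r b a := by
  by_contra! hcon
  obtain ⟨f, hf⟩ := exists_seq_of_forall_finset_exists (fun a => a ∈ S) (fun b a => ¬ r b a)
    (fun s hs => by
      obtain ⟨a, ha, hb⟩ := hcon s (fun x hx => hs x hx) s.finite_toSet
      exact ⟨a, ha, fun x hx => hb x hx⟩)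
  obtain ⟨m, n, hmn, hr⟩ := h f
  exact hf.2 m n hmn hr

end Basis

section Families
open Cardinal

/-- Families of elements of `Q` indexed by a type in `Type u`. -/
def Fam (Q : Type v) : Type (max (u + 1) v) := Σ I : Type u, I → Q

/-- Injective domination of families. -/
def FamLE {Q : Type v} (r : Q → Q → Prop) (F G : Fam.{u} Q) : Prop :=
  ∃ e : F.1 → G.1, Function.Injective e ∧ ∀ i, r (F.2 i) (G.2 (e i))

namespace Fam
variable {Q : Type v} (r : Q → Q → Prop) (F G : Fam.{u} Q)

/-- The quasi-order of indices of a family. -/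
def idxRel (i j : F.1) : Prop := r (F.2 i) (F.2 j)

/-- The number of members of the family above the `i`-th one. -/
def mult (i : F.1) : Cardinal.{u} := #{j // F.idxRel r i j}

/-- The indices with finitely many members above. -/
def small : Set F.1 := {i | F.mult r i < ℵ₀}

open Classical in
/-- A list of the members with small index. -/
noncomputable def finPart : List Q :=
  if h : (F.small r).Finite then h.toFinset.toList.map F.2 else []

/-- The members with large index, with their multiplicities. -/
def infPart : Set (Q × Cardinal.{u}) := {p | ∃ i, i ∉ F.small r ∧ p = (F.2 i, F.mult r i)}

variable {r F G}

theorem mem_range_of_mem_finPart {q : Q} (h : q ∈ F.finPart r) : q ∈ Set.range F.2 := by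
  unfold finPart at h
  split_ifs at h with hf
  · obtain ⟨i, -, rfl⟩ := List.mem_map.1 h
    exact ⟨i, rfl⟩
  · simp at h

theorem mk_lt_of_forall_mult_lt (hF : WellQuasiOrdered (F.idxRel r)) {c : Cardinal.{u}}
    (hc : ℵ₀ ≤ c) {S : Set F.1} (hS : ∀ i ∈ S, F.mult r i < c) : #S < c := by
  obtain ⟨B, hBS, hB, h⟩ := hF.exists_finite_basis S
  have key : ∀ B' : Set F.1, B'.Finite → (∀ i ∈ B', F.mult r i < c) →
      #(⋃ b ∈ B', {j | F.idxRel r b j} : Set F.1) < c := by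
    intro B' hB'
    induction B', hB' using Set.Finite.induction_on with
    | empty => intro _; simpa using aleph0_pos.trans_le hc
    | @insert b s _ _ ih =>
      intro hb
      rw [Set.biUnion_insert]
      exact (mk_union_le _ _).trans_lt (add_lt_of_lt hc (hb b (Set.mem_insert _ _))
        (ih fun i hi => hb i (Set.mem_insert_of_mem _ hi)))
  refine (mk_le_mk_of_subset fun a ha => ?_).trans_lt (key B hB fun i hi => hS i (hBS hi))
  obtain ⟨b, hb, hr⟩ := h a ha
  exact Set.mem_biUnion hb hr

theorem small_finite (hF : WellQuasiOrdered (F.idxRel r)) : (F.small r).Finite :=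
  lt_aleph0_iff_set_finite.1 (mk_lt_of_forall_mult_lt hF le_rfl fun _ hi => hi)

end Fam

theorem List.SublistForall₂.exists_injOn {I J : Type*} [Nonempty J] {R : I → J → Prop}
    {l : List I} {m : List J} (h : List.SublistForall₂ R l m) (hl : l.Nodup) (hm : m.Nodup) :
    ∃ e : I → J, Set.InjOn e {i | i ∈ l} ∧ ∀ i ∈ l, R i (e i) ∧ e i ∈ m := by
  classical
  induction h with
  | nil => exact ⟨fun _ => Classical.arbitrary J, by simp⟩
  | @cons a b l m hab _ ih =>
    rw [List.nodup_cons] at hl hm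
    obtain ⟨e, he, hR⟩ := ih hl.2 hm.2
    have hne : ∀ i ∈ l, i ≠ a := fun i hi h => hl.1 (h ▸ hi)
    refine ⟨Function.update e a b, ?_, ?_⟩
    · intro i hi j hj hij
      simp only [Set.mem_ofPred_eq, List.mem_cons] at hi hj
      rcases hi with rfl | hi <;> rcases hj with rfl | hj
      · rfl
      · rw [Function.update_self, Function.update_of_ne (hne j hj)] at hij
        exact absurd (hij ▸ (hR j hj).2) hm.1
      · rw [Function.update_self, Function.update_of_ne (hne i hi)] at hij
        exact absurd (hij ▸ (hR i hi).2) hm.1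
      · rw [Function.update_of_ne (hne i hi), Function.update_of_ne (hne j hj)] at hij
        exact he hi hj hij
    · intro i hi
      rcases List.mem_cons.1 hi with rfl | hi
      · simp [hab]
      · rw [Function.update_of_ne (hne i hi)]
        exact ⟨(hR i hi).1, List.mem_cons_of_mem _ (hR i hi).2⟩
  | cons_right _ ih =>
    rw [List.nodup_cons] at hm
    obtain ⟨e, he, hR⟩ := ih hl hm.2
    exact ⟨e, he, fun i hi => ⟨(hR i hi).1, List.mem_cons_of_mem _ (hR i hi).2⟩⟩

variable {Q : Type v} {r : Q → Q → Prop}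

/-- The quasi-order on pairs whose second components are cardinals. -/
def ProdCardLE (r : Q → Q → Prop) (a b : Q × Cardinal.{u}) : Prop := r a.1 b.1 ∧ a.2 ≤ b.2

theorem FamLE.of_parts (ht : ∀ a b c, r a b → r b c → r a c) {F G : Fam.{u} Q}
    (hF : WellQuasiOrdered (F.idxRel r)) (hG : WellQuasiOrdered (G.idxRel r))
    (h₁ : List.SublistForall₂ r (F.finPart r) (G.finPart r))
    (h₂ : HoareLE (ProdCardLE r) (F.infPart r) (G.infPart r)) : FamLE r F G := by
  classical
  have hFf := Fam.small_finite hF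
  have hGf := Fam.small_finite hG
  rw [Fam.finPart, Fam.finPart, dif_pos hFf, dif_pos hGf, List.sublistForall₂_map_left_iff,
    List.sublistForall₂_map_right_iff] at h₁
  have h₂' : ∀ i, i ∉ F.small r → ∃ j, r (F.2 i) (G.2 j) ∧ F.mult r i ≤ G.mult r j := by
    intro i hi
    obtain ⟨_, ⟨j, -, rfl⟩, h⟩ := h₂ _ ⟨i, hi, rfl⟩
    exact ⟨j, h⟩
  rcases isEmpty_or_nonempty F.1 with hFe | ⟨⟨i₀⟩⟩
  · exact ⟨fun i => hFe.elim i, fun i => hFe.elim i, fun i => hFe.elim i⟩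
  have : Nonempty G.1 := by
    by_cases hi : i₀ ∈ F.small r
    · by_contra hG0
      rw [not_nonempty_iff] at hG0
      have : (hGf.toFinset.toList : List G.1) = [] :=
        List.eq_nil_iff_forall_not_mem.2 fun a => hG0.elim a
      rw [this] at h₁
      obtain ⟨l, hl, hl'⟩ := List.sublistForall₂_iff.1 h₁
      rw [List.sublist_nil.1 hl', List.forall₂_nil_right_iff] at hl
      have : i₀ ∈ hFf.toFinset.toList := by simpa using hi
      simp [hl] at this
    · obtain ⟨j, -⟩ := h₂' i₀ hi
      exact ⟨j⟩
  obtain ⟨e₀, he₀, hR₀⟩ := h₁.exists_injOn (Finset.nodup_toList _) (Finset.nodup_toList _)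
  simp only [Finset.mem_toList, Set.Finite.mem_toFinset] at he₀ hR₀
  obtain ⟨e₁, he₁, hR₁⟩ := exists_injective_avoiding
    (I := {i // i ∉ F.small r}) (fun i j => r (F.2 i) (G.2 j)) (fun i => F.mult r i)
    (fun i => not_lt.1 i.2)
    (fun i => by
      obtain ⟨j, hj, hc⟩ := h₂' i i.2
      exact hc.trans (mk_le_mk_of_subset fun j' hj' => ht _ _ _ hj hj'))
    (fun i => by
      refine (mk_le_of_injective (β := {i' // F.mult r i' < F.mult r i})
        (f := fun i' => ⟨i'.1, i'.2⟩) ?_).trans_lt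
        (Fam.mk_lt_of_forall_mult_lt hF (not_lt.1 i.2) fun _ h => h)
      intro a b hab
      exact Subtype.ext (Subtype.ext (Subtype.mk.inj hab)))
    (fun i => by
      refine (mk_le_of_injective (β := {i' // F.mult r i' = F.mult r i})
        (f := fun i' => ⟨i'.1, i'.2⟩) ?_).trans (Order.lt_succ_iff.1
        (Fam.mk_lt_of_forall_mult_lt hF ((not_lt.1 i.2).trans (Order.le_succ _)) fun _ h => ?_))
      · intro a b hab
        exact Subtype.ext (Subtype.ext (Subtype.mk.inj hab))
      · exact Order.lt_succ_iff.2 (le_of_eq h))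
    (hFf.image e₀)
  refine ⟨fun i => if h : i ∈ F.small r then e₀ i else e₁ ⟨i, h⟩, ?_, ?_⟩
  · intro i j hij
    by_cases hi : i ∈ F.small r <;> by_cases hj : j ∈ F.small r
    · simp only [hi, hj, dif_pos] at hij
      exact he₀ hi hj hij
    · simp only [hi, hj, dif_pos, dif_neg, not_false_eq_true] at hij
      exact absurd (hij ▸ Set.mem_image_of_mem e₀ hi) (hR₁ ⟨j, hj⟩).2
    · simp only [hi, hj, dif_pos, dif_neg, not_false_eq_true] at hij
      exact absurd (hij ▸ Set.mem_image_of_mem e₀ hj) (hR₁ ⟨i, hi⟩).2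
    · simp only [hi, hj, dif_neg, not_false_eq_true] at hij
      exact congrArg Subtype.val (he₁ hij)
  · intro i
    by_cases hi : i ∈ F.small r
    · simpa only [hi, dif_pos] using (hR₀ i hi).1
    · simpa only [hi, dif_neg, not_false_eq_true] using (hR₁ ⟨i, hi⟩).1

/-- A bad array of families of well-quasi-ordered ranges has a bad array of members below it. -/
theorem Bad.exists_mem_of_fam (hr : ∀ a, r a a) (ht : ∀ a b c, r a b → r b c → r a c)
    {A : Set ℕ} {F : Set ℕ → Fam.{u} Q} (hF : Bad (FamLE r) A F)
    (hwqo : ∀ X ⊆ A, X.Infinite → WellQuasiOrdered ((F X).idxRel r)) :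
    ∃ B ⊆ A, ∃ c, Bad r B c ∧ ∀ X ⊆ B, X.Infinite → c X ∈ Set.range (F X).2 := by
  obtain ⟨B, hB, hBi, h₁⟩ := exists_perfect_or_bad (List.SublistForall₂ r) hF.infinite
    (hF.locConst.comp fun G => G.finPart r)
  rcases h₁ with h₁ | h₁
  · obtain ⟨C, hC, hCi, h₂⟩ := exists_perfect_or_bad (HoareLE (ProdCardLE r)) hBi
      ((hF.locConst.comp fun G => G.infPart r).mono hB)
    rcases h₂ with h₂ | h₂
    · have hCA := hC.trans hB
      refine absurd (FamLE.of_parts ht (hwqo C hCA hCi) (hwqo (tailSet C)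
        ((tailSet_subset C).trans hCA) (tailSet_infinite hCi)) (h₁ C hC hCi)
        (h₂ C subset_rfl hCi)) (hF.not_rel C hCA hCi)
    · obtain ⟨c, hc, hmem⟩ := h₂.exists_mem_of_hoareLE
      obtain ⟨D, hD, hd⟩ := Bad.fst_of_wellFoundedLT hc
      refine ⟨D, (hD.trans hC).trans hB, _, hd, fun X hX hXi => ?_⟩
      obtain ⟨i, -, h⟩ := hmem X (hX.trans hD) hXi
      exact ⟨i, by rw [h]⟩
  · obtain ⟨C, hC, c, hc, hmem⟩ := h₁.exists_mem_of_list hr ht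
    exact ⟨C, hC.trans hB, c, hc, fun X hX hXi =>
      Fam.mem_range_of_mem_finPart (hmem X hX hXi)⟩

end Families

section Coalgebra

variable {N : Type u} (ch : N → Set N)

/-- `Desc ch a b`: the node `b` is a descendant of the node `a` (possibly `a` itself). -/
def Desc : N → N → Prop := Relation.ReflTransGen fun a b => b ∈ ch a

/-- The children of `u` inject into those of a descendant of `w` in such a way that `P` holds
between every child and its image. -/
def SimStep (P : N → N → Prop) (u w : N) : Prop :=
  ∃ w', Desc ch w w' ∧ ∃ e : ch u → ch w', Function.Injective e ∧ ∀ c : ch u, P c (e c)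

/-- The largest relation contained in its own `SimStep`: embeddability of the unravelled trees. -/
def TLE (u w : N) : Prop := ∃ R : N → N → Prop, (∀ a b, R a b → SimStep ch R a b) ∧ R u w

variable {ch}

theorem SimStep.mono {P R : N → N → Prop} (h : ∀ a b, P a b → R a b) {u w : N}
    (hP : SimStep ch P u w) : SimStep ch R u w := by
  obtain ⟨w', hw, e, he, hPe⟩ := hP
  exact ⟨w', hw, e, he, fun c => h _ _ (hPe c)⟩

theorem TLE.step {u w : N} (h : TLE ch u w) : SimStep ch (TLE ch) u w := by
  obtain ⟨R, hR, huw⟩ := h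
  exact (hR _ _ huw).mono fun a b hab => ⟨R, hR, hab⟩

theorem Desc.tle {u v : N} (h : Desc ch u v) : TLE ch v u :=
  ⟨fun a b => Desc ch b a, fun a _ hab => ⟨a, hab, id, Function.injective_id, fun _ => .refl⟩, h⟩

theorem TLE.refl (u : N) : TLE ch u u := Desc.tle .refl

theorem TLE.exists_desc {v w v' : N} (h : TLE ch v w) (hv : Desc ch v v') :
    ∃ w', Desc ch w w' ∧ TLE ch v' w' := by
  induction hv with
  | refl => exact ⟨w, .refl, h⟩
  | @tail a b _ hb ih =>
    obtain ⟨w', hw', h'⟩ := ih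
    obtain ⟨w'', hw'', e, -, he⟩ := h'.step
    exact ⟨e ⟨b, hb⟩, (hw'.trans hw'').tail (e ⟨b, hb⟩).2, he ⟨b, hb⟩⟩

theorem TLE.trans {u v w : N} (h : TLE ch u v) (h' : TLE ch v w) : TLE ch u w := by
  refine ⟨fun a b => ∃ c, TLE ch a c ∧ TLE ch c b, ?_, v, h, h'⟩
  rintro a b ⟨c, hac, hcb⟩
  obtain ⟨c', hc', e, he, hle⟩ := hac.step
  obtain ⟨b', hb', hcb'⟩ := hcb.exists_desc hc'
  obtain ⟨b'', hb'', e', he', hle'⟩ := hcb'.step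
  exact ⟨b'', hb'.trans hb'', e' ∘ e, he'.comp he, fun x => ⟨e x, hle x, hle' (e x)⟩⟩

theorem TLE.of_forall_simStep {U W : Set N}
    (h : ∀ u ∈ U, ∀ w ∈ W, SimStep ch (fun c d => (c ∈ U → d ∈ W) ∧ (c ∉ U → TLE ch c d)) u w)
    {u w : N} (hu : u ∈ U) (hw : w ∈ W) : TLE ch u w := by
  refine ⟨fun a b => (a ∈ U ∧ b ∈ W) ∨ TLE ch a b, ?_, Or.inl ⟨hu, hw⟩⟩
  rintro a b (⟨ha, hb⟩ | hab)
  · refine (h a ha b hb).mono fun c d hcd => ?_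
    by_cases hc : c ∈ U
    · exact Or.inl ⟨hc, hcd.1 hc⟩
    · exact Or.inr (hcd.2 hc)
  · exact hab.step.mono fun c d => Or.inr

variable (ch)

/-- `TLE` with an additional isolated element. -/
def OptTLE (a b : Option N) : Prop :=
  (a = none ∧ b = none) ∨ ∃ x y, a = some x ∧ b = some y ∧ TLE ch x y

open Classical in
/-- The family of children of `u`, with those in `U` forgotten. -/
noncomputable def childFam (U : Set N) (u : N) : Fam.{u} (Option N) :=
  ⟨ch u, fun c => if (c : N) ∈ U then none else some c⟩

/-- The descendants of `t` which are equivalent to `t`. -/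
def eqDesc (t : N) : Set N := {s | Desc ch t s ∧ TLE ch t s}

/-- `SLT ch s t`: the node `s` is a descendant of `t` strictly below `t` for `TLE`. -/
def SLT (s t : N) : Prop := Desc ch t s ∧ ¬ TLE ch t s

variable {ch}

theorem OptTLE.refl (a : Option N) : OptTLE ch a a := by
  cases a with
  | none => exact Or.inl ⟨rfl, rfl⟩
  | some x => exact Or.inr ⟨x, x, rfl, rfl, TLE.refl x⟩

theorem OptTLE.trans {a b c : Option N} (h : OptTLE ch a b) (h' : OptTLE ch b c) :
    OptTLE ch a c := by
  rcases h with ⟨rfl, rfl⟩ | ⟨x, y, rfl, rfl, hxy⟩ <;>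
    rcases h' with ⟨h1, rfl⟩ | ⟨x', y', h1, rfl, hxy'⟩
  · exact Or.inl ⟨rfl, rfl⟩
  · cases h1
  · cases h1
  · cases h1
    exact Or.inr ⟨_, _, rfl, rfl, hxy.trans hxy'⟩

theorem exists_of_childFam_le {U W : Set N} {u w : N}
    (h : FamLE (OptTLE ch) (childFam ch U u) (childFam ch W w)) :
    ∃ e : ch u → ch w, Function.Injective e ∧
      ∀ c : ch u, ((c : N) ∈ U → (e c : N) ∈ W) ∧ ((c : N) ∉ U → TLE ch c (e c)) := by
  obtain ⟨e, he, h⟩ := h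
  refine ⟨e, he, fun c => ?_⟩
  have hc := h c
  unfold OptTLE childFam at hc
  constructor
  · intro hcU
    by_contra hW
    simp [hcU, hW] at hc
  · intro hcU
    simp only [hcU, if_false, reduceCtorEq, false_and, false_or] at hc
    obtain ⟨x, y, hx, hy, hxy⟩ := hc
    split_ifs at hy
    cases hx
    cases hy
    exact hxy

theorem self_mem_eqDesc (t : N) : t ∈ eqDesc ch t := ⟨.refl, TLE.refl t⟩

theorem TLE.of_hoareLE {T S : N}
    (h : HoareLE (FamLE (OptTLE ch)) (childFam ch (eqDesc ch T) '' eqDesc ch T)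
      (childFam ch (eqDesc ch S) '' eqDesc ch S)) : TLE ch T S := by
  refine TLE.of_forall_simStep (U := eqDesc ch T) (W := eqDesc ch S) ?_ (self_mem_eqDesc T)
    (self_mem_eqDesc S)
  intro t ht w hw
  obtain ⟨_, ⟨s, hs, rfl⟩, hle⟩ := h _ ⟨t, ht, rfl⟩
  obtain ⟨e, he, hle⟩ := exists_of_childFam_le hle
  obtain ⟨w', hw', hsw⟩ := hw.2.exists_desc hs.1
  obtain ⟨w'', hw'', e', he', hle'⟩ := hsw.step
  refine ⟨w'', hw'.trans hw'', e' ∘ e, he'.comp he, fun c => ⟨fun hc => ⟨?_, ?_⟩, fun hc => ?_⟩⟩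
  · exact ((hw.1.trans hw').trans hw'').tail (e' (e c)).2
  · exact ((hle c).1 hc).2.trans (hle' _)
  · exact ((hle c).2 hc).trans (hle' _)

theorem SLT.trans {a b c : N} (h : SLT ch a b) (h' : SLT ch b c) : SLT ch a c :=
  ⟨h'.1.trans h.1, fun hca => h'.2 (hca.trans h.1.tle)⟩

theorem wellQuasiOrdered_childFam {U : Set N} {u : N}
    (h : (ch u \ U).PartiallyWellOrderedOn (TLE ch)) :
    WellQuasiOrdered ((childFam ch U u).idxRel (OptTLE ch)) := by
  intro f
  change ℕ → ch u at f
  by_cases hU : ∃ m n, m < n ∧ (f m : N) ∈ U ∧ (f n : N) ∈ U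
  · obtain ⟨m, n, hmn, hm, hn⟩ := hU
    refine ⟨m, n, hmn, Or.inl ⟨?_, ?_⟩⟩ <;> simp [childFam, hm, hn]
  · have hk : ∃ k, ∀ n, (f (k + n) : N) ∉ U := by
      by_contra! hcon
      obtain ⟨m, hm⟩ := hcon 0
      obtain ⟨n, hn⟩ := hcon (0 + m + 1)
      exact hU ⟨0 + m, 0 + m + 1 + n, by omega, hm, hn⟩
    obtain ⟨k, hk⟩ := hk
    obtain ⟨m, n, hmn, hle⟩ :=
      (Set.partiallyWellOrderedOn_iff_exists_lt.1 h) (fun n => (f (k + n) : N))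
        (fun n => ⟨(f (k + n)).2, hk n⟩)
    refine ⟨k + m, k + n, by omega, Or.inr ⟨f (k + m), f (k + n), ?_, ?_, hle⟩⟩ <;>
      simp [childFam, hk]

theorem Bad.exists_child {A : Set ℕ} {F : Set ℕ → Set N × N}
    (hF : Bad (FamLE (OptTLE ch)) A fun X => childFam ch (F X).1 (F X).2)
    (h : ∀ X ⊆ A, X.Infinite → (ch (F X).2 \ (F X).1).PartiallyWellOrderedOn (TLE ch)) :
    ∃ B ⊆ A, ∃ d, Bad (TLE ch) B d ∧ ∀ X ⊆ B, X.Infinite → d X ∈ ch (F X).2 \ (F X).1 := by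
  obtain ⟨B, hB, c, hc, hmem⟩ := hF.exists_mem_of_fam OptTLE.refl
    (fun a b c => OptTLE.trans) (fun X hX hXi => wellQuasiOrdered_childFam (h X hX hXi))
  obtain ⟨C, hC, hCi, h1⟩ := exists_homogeneous hc.infinite (hc.locConst.comp fun a => a = none)
  rcases h1 with h1 | h1
  · refine absurd (Or.inl ⟨h1 C subset_rfl hCi, ?_⟩) (hc.not_rel C hC hCi)
    exact h1 _ (tailSet_subset C) (tailSet_infinite hCi)
  · obtain ⟨x₀, -⟩ := Option.ne_none_iff_exists.1 (h1 C subset_rfl hCi)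
    have hs : ∀ X ⊆ C, X.Infinite → c X = some ((c X).getD x₀) := by
      intro X hX hXi
      obtain ⟨x, hx⟩ := Option.ne_none_iff_exists.1 (h1 X hX hXi)
      simp [← hx]
    refine ⟨C, hC.trans hB, fun X => (c X).getD x₀,
      ⟨hCi, (hc.locConst.comp fun a => a.getD x₀).mono hC, fun X hX hXi hle => ?_⟩, ?_⟩
    · exact hc.not_rel X (hX.trans hC) hXi (Or.inr ⟨_, _, hs X hX hXi,
        hs _ ((tailSet_subset X).trans hX) (tailSet_infinite hXi), hle⟩)
    · intro X hX hXi
      obtain ⟨i, hi⟩ := hmem X (hX.trans hC) hXi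
      rw [hs X hX hXi] at hi
      unfold childFam at hi i
      change ch (F X).2 at i
      by_cases hiU : (i : N) ∈ (F X).1
      · simp [hiU] at hi
      · simp only [hiU, if_false, Option.some.injEq] at hi
        change (c X).getD x₀ ∈ _
        rw [← hi]
        exact ⟨i.2, hiU⟩

theorem SLT.of_mem_child {T t c : N} (ht : t ∈ eqDesc ch T) (hc : c ∈ ch t \ eqDesc ch T) :
    SLT ch c T :=
  have h := ht.1.tail hc.1
  ⟨h, fun hT => hc.2 ⟨h, hT⟩⟩

/-- A minimal bad array cannot have well-quasi-ordered sets of strictly smaller descendants. -/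
theorem not_minimal_bad {A : Set ℕ} {f : Set ℕ → N} (hf : Bad (TLE ch) A f)
    (hmin : ∀ C h, Bad (TLE ch) C h → ¬ ArrayBelow (SLT ch) C h A f)
    (hwqo : ∀ X ⊆ A, X.Infinite → {t | SLT ch t (f X)}.PartiallyWellOrderedOn (TLE ch)) :
    False := by
  have h1 : Bad (HoareLE fun a b : Set N × N => FamLE (OptTLE ch) (childFam ch a.1 a.2)
      (childFam ch b.1 b.2)) A
      fun X => (fun t => (eqDesc ch (f X), t)) '' eqDesc ch (f X) := by
    refine ⟨hf.infinite, hf.locConst.comp fun T => (fun t => (eqDesc ch T, t)) '' eqDesc ch T,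
      fun X hX hXi hle => hf.not_rel X hX hXi (TLE.of_hoareLE ?_)⟩
    rintro _ ⟨t, ht, rfl⟩
    obtain ⟨_, ⟨s, hs, rfl⟩, h⟩ := hle _ ⟨t, ht, rfl⟩
    exact ⟨_, ⟨s, hs, rfl⟩, h⟩
  obtain ⟨c, hc, hmem⟩ := h1.exists_mem_of_hoareLE
  have hch : ∀ X ⊆ A, X.Infinite → ∀ x ∈ ch (c X).2 \ (c X).1, SLT ch x (f X) := by
    intro X hX hXi x hx
    obtain ⟨t, ht, h⟩ := hmem X hX hXi
    rw [← h] at hx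
    exact SLT.of_mem_child ht hx
  obtain ⟨B, hB, d, hd, hdmem⟩ := Bad.exists_child (F := c)
    ⟨hc.infinite, hc.locConst.comp fun p => childFam ch p.1 p.2, hc.not_rel⟩
    fun X hX hXi => (hwqo X hX hXi).mono (hch X hX hXi)
  exact hmin B d hd ⟨hB, fun X hX hXi => hch X (hX.trans hB) hXi _ (hdmem X hX hXi)⟩

theorem bad_of_seq {Q : Type*} {r : Q → Q → Prop} {f : ℕ → Q} (h : ∀ m n, m < n → ¬ r (f m) (f n)) :
    Bad r Set.univ fun X => f (sInf X) := by
  refine ⟨Set.infinite_univ, locConst_sInf f, fun X _ hXi => h _ _ ?_⟩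
  have hmem := Nat.sInf_mem (tailSet_infinite hXi).nonempty
  exact lt_of_le_of_ne (Nat.sInf_le (tailSet_subset X hmem)) fun h => hmem.2 h.symm

theorem partiallyWellOrderedOn_slt {T : N} (hT : Acc (SLT ch) T) :
    {t | SLT ch t T}.PartiallyWellOrderedOn (TLE ch) := by
  induction hT with
  | intro T hT ih =>
    refine Set.partiallyWellOrderedOn_iff_exists_lt.2 fun f hf => ?_
    by_contra! hcon
    obtain ⟨B, g, hg, hgf, hmin⟩ := (bad_of_seq hcon).exists_minimal (fun a b c => TLE.trans)
      (fun a b c => SLT.trans) (fun a b h => h.1.tle) fun X _ _ => hT _ (hf _)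
    refine not_minimal_bad hg hmin fun X hX hXi => ih _ ?_
    rcases hgf.2 X hX hXi with h | h
    · exact h.trans (hf _)
    · exact h ▸ hf _

theorem not_bad_of_acc {A : Set ℕ} {f : Set ℕ → N} (hf : Bad (TLE ch) A f)
    (hacc : ∀ X ⊆ A, X.Infinite → Acc (SLT ch) (f X)) : False := by
  obtain ⟨B, g, hg, hgf, hmin⟩ := hf.exists_minimal (fun a b c => TLE.trans)
      (fun a b c => SLT.trans) (fun a b h => h.1.tle) hacc
  refine not_minimal_bad hg hmin fun X hX hXi => partiallyWellOrderedOn_slt ?_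
  have h := hacc X (hX.trans hgf.1) hXi
  rcases hgf.2 X hX hXi with h' | h'
  · exact h.inv h'
  · exact h' ▸ h

theorem exists_childFam_le_of_acc (F : ℕ → Set N × N)
    (hF : ∀ n, ∀ c ∈ ch (F n).2 \ (F n).1, Acc (SLT ch) c) :
    ∃ m n, m < n ∧ FamLE (OptTLE ch) (childFam ch (F m).1 (F m).2)
      (childFam ch (F n).1 (F n).2) := by
  by_contra! hcon
  obtain ⟨B, hB, d, hd, hmem⟩ := Bad.exists_child (ch := ch) (F := fun X => F (sInf X))
    (bad_of_seq (f := fun n => childFam ch (F n).1 (F n).2) hcon) fun X hX hXi => by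
      refine Set.partiallyWellOrderedOn_iff_exists_lt.2 fun f hf => ?_
      by_contra! hcon
      exact not_bad_of_acc (bad_of_seq hcon) fun Y _ _ => hF _ _ (hf _)
  exact not_bad_of_acc hd fun X hX hXi => hF _ _ (hmem X hX hXi)

/-- Passing to strictly smaller descendants is well-founded. -/
theorem wellFounded_slt : WellFounded (SLT ch) := by
  refine ⟨fun T₀ => ?_⟩
  by_contra hT₀
  let U : Set N := {t | ¬ Acc (SLT ch) t}
  have ht : ∃ t ∈ U, ∀ s ∈ U, Desc ch t s → ∀ u ∈ U, Desc ch t u → ∃ u' ∈ U, Desc ch s u' ∧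
      FamLE (OptTLE ch) (childFam ch U u) (childFam ch U u') := by
    by_contra! hcon
    choose! s hsU hs u huU hu hsu using hcon
    let t : ℕ → N := fun n => s^[n] T₀
    have ht : ∀ n, t (n + 1) = s (t n) := fun n => Function.iterate_succ_apply' s n T₀
    have htU : ∀ n, t n ∈ U := by
      intro n
      induction n with
      | zero => exact hT₀
      | succ n ih => exact ht n ▸ hsU _ ih
    have hdesc : ∀ m n, m ≤ n → Desc ch (t m) (t n) := by
      intro m n hmn
      induction n, hmn using Nat.le_induction with
      | base => exact .refl
      | succ n _ ih => exact ih.trans (ht n ▸ hs _ (htU n))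
    obtain ⟨m, n, hmn, hle⟩ := exists_childFam_le_of_acc (ch := ch) (fun n => (U, u (t n)))
      fun n c hc => not_not.1 hc.2
    refine hsu _ (htU m) _ (huU _ (htU n)) ?_ hle
    exact (ht m ▸ hdesc (m + 1) n hmn).trans (hu _ (htU n))
  obtain ⟨t, htU, ht⟩ := ht
  refine htU ⟨_, fun s hs => ?_⟩
  by_contra hsU
  refine hs.2 (TLE.of_forall_simStep (U := U ∩ {x | Desc ch t x}) (W := U ∩ {x | Desc ch t x})
    ?_ ⟨htU, .refl⟩ ⟨hsU, hs.1⟩)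
  intro u hu w hw
  obtain ⟨u', hu'U, hu', hle⟩ := ht w hw.1 hw.2 u hu.1 hu.2
  obtain ⟨e, he, hle⟩ := exists_of_childFam_le hle
  refine ⟨u', hu', e, he, fun c => ⟨fun hc => ⟨(hle c).1 hc.1, ?_⟩, fun hc => (hle c).2 ?_⟩⟩
  · exact (hw.2.trans hu').tail (e c).2
  · exact fun hcU => hc ⟨hcU, hu.2.tail c.2⟩

theorem wellQuasiOrdered_childFam_le : WellQuasiOrdered fun a b : Set N × N =>
    FamLE (OptTLE ch) (childFam ch a.1 a.2) (childFam ch b.1 b.2) :=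
  fun F => exists_childFam_le_of_acc F fun _ _ _ => wellFounded_slt.apply _

theorem wellQuasiOrdered_tle : WellQuasiOrdered (TLE ch) := by
  intro f
  by_contra! hcon
  exact not_bad_of_acc (bad_of_seq hcon) fun _ _ _ => wellFounded_slt.apply _

end Coalgebra

section Coding
open Cardinal

variable {K : Type u} [Infinite K]

theorem exists_code_hoareLE {Q : Type*} {r : Q → Q → Prop} (ht : ∀ a b c, r a b → r b c → r a c)
    (hw : WellQuasiOrdered r) (P : Set Q) (φ : Q → K)
    (hφ : ∀ x ∈ P, ∀ y ∈ P, φ x = φ y → r x y) :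
    ∃ g : Set Q → K, ∀ A ⊆ P, ∀ A' ⊆ P, g A = g A' → HoareLE r A A' := by
  classical
  have hB : ∀ A : Set Q, ∃ B : Finset Q, (∀ b ∈ B, b ∈ P ∧ ¬ ∃ a ∈ A, r b a) ∧
      ∀ x ∈ P, (¬ ∃ a ∈ A, r x a) → ∃ b ∈ B, r b x := by
    intro A
    obtain ⟨B, hB, hfin, hbas⟩ := hw.exists_finite_basis {x | x ∈ P ∧ ¬ ∃ a ∈ A, r x a}
    refine ⟨hfin.toFinset, fun b hb => hB (hfin.mem_toFinset.1 hb), fun x hx hxA => ?_⟩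
    obtain ⟨b, hb, hbx⟩ := hbas x ⟨hx, hxA⟩
    exact ⟨b, hfin.mem_toFinset.2 hb, hbx⟩
  choose B hBP hB using hB
  obtain ⟨e⟩ : Nonempty (Finset K ≃ K) := Cardinal.eq.1 (mk_finset_of_infinite K)
  refine ⟨fun A => e ((B A).image φ), fun A hA A' _ h a ha => ?_⟩
  by_contra hcon
  obtain ⟨b, hb, hba⟩ := hB A' a (hA ha) hcon
  have hmem : φ b ∈ (B A).image φ := by
    rw [e.injective h]
    exact Finset.mem_image_of_mem φ hb
  obtain ⟨b', hb', heq⟩ := Finset.mem_image.1 hmem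
  exact (hBP A b' hb').2 ⟨a, ha, ht _ _ _ (hφ b' (hBP A b' hb').1 b (hBP A' b hb).1 heq) hba⟩

variable (K) in
theorem exists_injOn_Iic_mk : ∃ ψ : Cardinal.{u} → K, Set.InjOn ψ (Set.Iic #K) := by
  classical
  have hle : #(Option (#K).ord.ToType) ≤ #K := by
    rw [mk_option, mk_ord_toType]
    exact (add_one_eq (aleph0_le_mk K)).le
  obtain ⟨e⟩ := (Cardinal.le_def _ _).1 hle
  refine ⟨fun c => e (if h : c < #K then some (Ordinal.ToType.mk ⟨c.ord, ord_lt_ord.2 h⟩)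
    else none), fun c hc d hd h => ?_⟩
  have h := e.injective h
  split_ifs at h with h₁ h₂ h₂
  · have := Ordinal.ToType.mk.injective (Option.some.inj h)
    exact ord_injective (congrArg Subtype.val this)
  · exact (le_antisymm hc (not_lt.1 h₁)).trans (le_antisymm hd (not_lt.1 h₂)).symm

theorem List.sublistForall₂_of_map_eq {Q L : Type*} {r : Q → Q → Prop} {P : Set Q} {φ : Q → L}
    (hφ : ∀ x ∈ P, ∀ y ∈ P, φ x = φ y → r x y) {l m : List Q} (hl : ∀ x ∈ l, x ∈ P)
    (hm : ∀ x ∈ m, x ∈ P) (h : l.map φ = m.map φ) : List.SublistForall₂ r l m := by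
  induction l generalizing m with
  | nil => exact .nil
  | cons a l ih =>
    cases m with
    | nil => simp at h
    | cons b m =>
      simp only [List.map_cons, List.cons.injEq] at h
      exact .cons (hφ a (hl a (by simp)) b (hm b (by simp)) h.1)
        (ih (fun x hx => hl x (by simp [hx])) (fun x hx => hm x (by simp [hx])) h.2)

theorem wellQuasiOrdered_prodCardLE {Q : Type v} {r : Q → Q → Prop} (hr : ∀ a, r a a)
    (ht : ∀ a b c, r a b → r b c → r a c) (hw : WellQuasiOrdered r) :
    WellQuasiOrdered (ProdCardLE.{u} r) := by
  have : IsPreorder Q r := { refl := hr, trans := ht }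
  exact WellQuasiOrdered.prod hw wellQuasiOrdered_le

theorem exists_code_famLE {Q : Type v} {r : Q → Q → Prop} (hr : ∀ a, r a a)
    (ht : ∀ a b c, r a b → r b c → r a c) (hw : WellQuasiOrdered r) (P : Set Q) (φ : Q → K)
    (hφ : ∀ x ∈ P, ∀ y ∈ P, φ x = φ y → r x y) :
    ∃ g : Fam.{u} Q → K, ∀ F G : Fam.{u} Q, Set.range F.2 ⊆ P → Set.range G.2 ⊆ P →
      #F.1 ≤ #K → #G.1 ≤ #K → g F = g G → FamLE r F G := by
  obtain ⟨ψ, hψ⟩ := exists_injOn_Iic_mk K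
  obtain ⟨e₂⟩ : Nonempty (K × K ≃ K) := by
    refine Cardinal.eq.1 ?_
    rw [mk_prod, lift_id, mul_eq_self (aleph0_le_mk K)]
  obtain ⟨e₁⟩ : Nonempty (List K ≃ K) := Cardinal.eq.1 (mk_list_eq_mk K)
  obtain ⟨g, hg⟩ := exists_code_hoareLE (r := ProdCardLE.{u} r)
    (fun a b c h h' => ⟨ht _ _ _ h.1 h'.1, h.2.trans h'.2⟩)
    (wellQuasiOrdered_prodCardLE hr ht hw) {p | p.1 ∈ P ∧ p.2 ≤ #K}
    (fun p => e₂ (φ p.1, ψ p.2)) (by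
      intro x hx y hy hxy
      have := e₂.injective hxy
      rw [Prod.mk.injEq] at this
      exact ⟨hφ _ hx.1 _ hy.1 this.1, (hψ hx.2 hy.2 this.2).le⟩)
  have hidx : ∀ F : Fam.{u} Q, WellQuasiOrdered (F.idxRel r) := fun F f => hw (F.2 ∘ f)
  have hinf : ∀ F : Fam.{u} Q, Set.range F.2 ⊆ P → #F.1 ≤ #K →
      F.infPart r ⊆ {p | p.1 ∈ P ∧ p.2 ≤ #K} := by
    rintro F hF hK p ⟨i, -, rfl⟩
    exact ⟨hF ⟨i, rfl⟩, (mk_subtype_le _).trans hK⟩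
  refine ⟨fun F => e₂ (e₁ ((F.finPart r).map φ), g (F.infPart r)),
    fun F G hF hG hFK hGK h => ?_⟩
  have h := e₂.injective h
  rw [Prod.mk.injEq] at h
  exact FamLE.of_parts ht (hidx F) (hidx G)
    (List.sublistForall₂_of_map_eq hφ (fun x hx => hF (F.mem_range_of_mem_finPart hx))
      (fun x hx => hG (G.mem_range_of_mem_finPart hx)) (e₁.injective h.1))
    (hg _ (hinf F hF hFK) _ (hinf G hG hGK) h.2)

variable {N : Type u} {ch : N → Set N}

variable (ch) in
theorem wellQuasiOrdered_optTLE : WellQuasiOrdered (OptTLE ch) := by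
  intro f
  by_cases h : ∃ m n, m < n ∧ f m = none ∧ f n = none
  · obtain ⟨m, n, hmn, hm, hn⟩ := h
    exact ⟨m, n, hmn, Or.inl ⟨hm, hn⟩⟩
  · obtain ⟨k, hk⟩ : ∃ k, ∀ n, k < n → f n ≠ none := by
      by_contra! hcon
      obtain ⟨m, -, hm⟩ := hcon 0
      obtain ⟨n, hn, hn'⟩ := hcon m
      exact h ⟨m, n, hn, hm, hn'⟩
    choose x hx using fun n => Option.ne_none_iff_exists'.1 (hk (k + 1 + n) (by omega))
    obtain ⟨m, n, hmn, hle⟩ := wellQuasiOrdered_tle (ch := ch) x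
    exact ⟨k + 1 + m, k + 1 + n, by omega, Or.inr ⟨_, _, hx m, hx n, hle⟩⟩

instance : IsWellFounded N (SLT ch) := ⟨wellFounded_slt⟩

theorem exists_code_rank_eq (hch : ∀ t, #(ch t) ≤ #K) (α : Ordinal.{u}) (g : N → K)
    (hg : ∀ x y, IsWellFounded.rank (SLT ch) x < α → IsWellFounded.rank (SLT ch) y < α →
      g x = g y → TLE ch x y) :
    ∃ g' : N → K, ∀ x y, IsWellFounded.rank (SLT ch) x = α →
      IsWellFounded.rank (SLT ch) y = α → g' x = g' y → TLE ch x y := by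
  obtain ⟨e⟩ : Nonempty (Option K ≃ K) := by
    refine Cardinal.eq.1 ?_
    rw [mk_option, add_one_eq (aleph0_le_mk K)]
  obtain ⟨gF, hgF⟩ := exists_code_famLE (r := OptTLE ch) (OptTLE.refl ·)
    (fun _ _ _ h h' => h.trans h') (wellQuasiOrdered_optTLE ch)
    {o | ∀ c ∈ o, IsWellFounded.rank (SLT ch) c < α} (fun o => e (o.map g)) (by
      rintro (_ | x) hx (_ | y) hy h
      · exact OptTLE.refl none
      · exact (Option.some_ne_none _ (e.injective h).symm).elim
      · exact (Option.some_ne_none _ (e.injective h)).elim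
      · exact Or.inr ⟨x, y, rfl, rfl, hg x y (hx x rfl) (hy y rfl)
          (Option.some.inj (e.injective h))⟩)
  have hrange : ∀ T t, IsWellFounded.rank (SLT ch) T = α → t ∈ eqDesc ch T →
      Set.range (childFam ch (eqDesc ch T) t).2 ⊆
        {o | ∀ c ∈ o, IsWellFounded.rank (SLT ch) c < α} := by
    rintro T t rfl ht _ ⟨⟨c, hc⟩, rfl⟩ d hd
    simp only [childFam] at hd
    split_ifs at hd with hcT
    · simp at hd
    · obtain rfl : c = d := by simpa using hd
      exact IsWellFounded.rank_lt_of_rel (SLT.of_mem_child ht ⟨hc, hcT⟩)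
  obtain ⟨G, hG⟩ := exists_code_hoareLE (K := K)
    (r := fun a b : Set N × N => FamLE (OptTLE ch) (childFam ch a.1 a.2) (childFam ch b.1 b.2))
    (by
      rintro a b c ⟨i, hi, h⟩ ⟨j, hj, h'⟩
      exact ⟨j ∘ i, hj.comp hi, fun x => (h x).trans (h' _)⟩)
    wellQuasiOrdered_childFam_le
    {p | ∃ T, IsWellFounded.rank (SLT ch) T = α ∧ p.1 = eqDesc ch T ∧ p.2 ∈ eqDesc ch T}
    (fun p => gF (childFam ch p.1 p.2)) (by
      rintro ⟨_, x⟩ ⟨T, hT, rfl, hx⟩ ⟨_, y⟩ ⟨S, hS, rfl, hy⟩ h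
      exact hgF _ _ (hrange T x hT hx) (hrange S y hS hy) (hch x) (hch y) h)
  refine ⟨fun T => G {p | p.1 = eqDesc ch T ∧ p.2 ∈ eqDesc ch T}, fun T S hT hS h => ?_⟩
  have := hG _ (fun p hp => ⟨T, hT, hp⟩) _ (fun p hp => ⟨S, hS, hp⟩) h
  refine TLE.of_hoareLE ?_
  rintro _ ⟨t, ht, rfl⟩
  obtain ⟨⟨_, s⟩, ⟨rfl, hs⟩, hle⟩ := this (eqDesc ch T, t) ⟨rfl, ht⟩
  exact ⟨_, ⟨s, hs, rfl⟩, hle⟩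

theorem exists_code_rank_lt_of_forall {f : N → Ordinal.{u}} {α : Ordinal.{u}} (hα : α.card ≤ #K)
    (h : ∀ β < α, ∃ g : N → K, ∀ x y, f x = β → f y = β → g x = g y → TLE ch x y) :
    ∃ g : N → K, ∀ x y, f x < α → f y < α → g x = g y → TLE ch x y := by
  classical
  choose! g hg using h
  obtain ⟨e⟩ : Nonempty (K × K ≃ K) := by
    refine Cardinal.eq.1 ?_
    rw [mk_prod, lift_id, mul_eq_self (aleph0_le_mk K)]
  obtain ⟨i⟩ : Nonempty (α.ToType ↪ K) := by
    rw [← Cardinal.le_def, Cardinal.mk_toType]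
    exact hα
  obtain ⟨k⟩ : Nonempty K := inferInstance
  refine ⟨fun x => e (if hx : f x < α then i (Ordinal.ToType.mk ⟨f x, hx⟩) else k, g (f x) x),
    fun x y hx hy h => ?_⟩
  have h := e.injective h
  rw [Prod.mk.injEq, dif_pos hx, dif_pos hy] at h
  have hxy : f x = f y :=
    congrArg Subtype.val (Ordinal.ToType.mk.injective (i.injective h.1))
  exact hg (f x) hx x y rfl hxy.symm (by rw [h.2, hxy])

theorem rank_slt_lt (hch : ∀ t, #{s // Desc ch t s} ≤ #K) (t : N) :
    IsWellFounded.rank (SLT ch) t < (Order.succ #K).ord := by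
  induction t using (wellFounded_slt (ch := ch)).induction with
  | _ t ih =>
    rw [IsWellFounded.rank_eq]
    simp only [Order.succ_eq_add_one]
    refine Ordinal.iSup_add_one_lt_of_lt_cof ?_ fun i => ih i.1 i.2
    rw [(isRegular_succ (aleph0_le_mk K)).cof_ord, Order.lt_succ_iff]
    exact (mk_subtype_mono fun s hs => hs.1).trans (hch t)

theorem exists_code_tle (hch : ∀ t, #{s // Desc ch t s} ≤ #K) :
    ∃ g : N → (Order.succ #K).ord.ToType × K, ∀ x y, g x = g y → TLE ch x y := by
  have hch' : ∀ t, #(ch t) ≤ #K := fun t =>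
    (mk_subtype_mono fun s hs => Relation.ReflTransGen.single hs).trans (hch t)
  have key : ∀ α : Ordinal.{u}, α < (Order.succ #K).ord → ∃ g : N → K, ∀ x y,
      IsWellFounded.rank (SLT ch) x = α → IsWellFounded.rank (SLT ch) y = α →
        g x = g y → TLE ch x y := by
    intro α
    induction α using WellFoundedLT.induction with
    | _ α ih =>
      intro hα
      obtain ⟨g, hg⟩ := exists_code_rank_lt_of_forall (K := K) (ch := ch)
        (f := IsWellFounded.rank (SLT ch)) (Order.lt_succ_iff.1 (lt_ord.1 hα))
        fun β hβ => ih β hβ (hβ.trans hα)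
      exact exists_code_rank_eq hch' α g hg
  choose! g hg using key
  refine ⟨fun x => (Ordinal.ToType.mk ⟨_, rank_slt_lt hch x⟩,
    g (IsWellFounded.rank (SLT ch) x) x), fun x y h => ?_⟩
  rw [Prod.mk.injEq] at h
  have hxy : IsWellFounded.rank (SLT ch) x = IsWellFounded.rank (SLT ch) y :=
    congrArg Subtype.val (Ordinal.ToType.mk.injective h.1)
  exact hg _ (rank_slt_lt hch x) x y rfl hxy.symm (by rw [h.2, hxy])

end Coding

section Arborescence
open Relation

/-- `C` is the child relation of a tree with root `r` and depth function `d`. -/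
structure IsArborescence {V : Type u} (C : V → V → Prop) (r : V) (d : V → ℕ) : Prop where
  depth : ∀ {a b}, C a b → d b = d a + 1
  parent_unique : ∀ {a b c}, C a c → C b c → a = b
  root_desc : ∀ v, ReflTransGen C r v

namespace IsArborescence

variable {V : Type u} {C : V → V → Prop} {r : V} {d : V → ℕ}

theorem depth_le (hC : IsArborescence C r d) {a b : V} (h : ReflTransGen C a b) : d a ≤ d b := by
  induction h with
  | refl => exact le_rfl
  | tail _ h ih => have := hC.depth h; omega

theorem eq_of_depth_le (hC : IsArborescence C r d)
    {a b : V} (h : ReflTransGen C a b) (hd : d b ≤ d a) : a = b := by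
  rcases h.cases_head with h | ⟨c, hac, hcb⟩
  · exact h
  · have := hC.depth hac
    have := hC.depth_le hcb
    omega

theorem antisymm (hC : IsArborescence C r d)
    {a b : V} (h : ReflTransGen C a b) (h' : ReflTransGen C b a) : a = b :=
  hC.eq_of_depth_le h (hC.depth_le h')

theorem desc_or_desc (hC : IsArborescence C r d)
    {a b x : V} (ha : ReflTransGen C a x) (hb : ReflTransGen C b x) :
    ReflTransGen C a b ∨ ReflTransGen C b a := by
  induction ha with
  | refl => exact Or.inr hb
  | @tail y z hy hyz ih =>
    rcases hb.cases_tail with h | ⟨w, hbw, hwz⟩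
    · exact Or.inl (h ▸ hy.tail hyz)
    · exact ih (hC.parent_unique hwz hyz ▸ hbw)

theorem desc_tail (hC : IsArborescence C r d)
    {a b c : V} (h : ReflTransGen C a c) (hbc : C b c) (hne : a ≠ c) :
    ReflTransGen C a b := by
  rcases h.cases_tail with h | ⟨w, haw, hwc⟩
  · exact (hne h.symm).elim
  · exact hC.parent_unique hwc hbc ▸ haw

theorem eq_or_eq_of_between (hC : IsArborescence C r d)
    {a b x : V} (hab : C a b) (hax : ReflTransGen C a x)
    (hxb : ReflTransGen C x b) : x = a ∨ x = b := by
  by_cases h : x = b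
  · exact Or.inr h
  · exact Or.inl (hC.antisymm (hC.desc_tail hxb hab h) hax)

theorem eq_of_siblings (hC : IsArborescence C r d)
    {v c c' x : V} (hc : C v c) (hc' : C v c') (hx : ReflTransGen C c x)
    (hx' : ReflTransGen C c' x) : c = c' := by
  have := hC.depth hc
  have := hC.depth hc'
  rcases hC.desc_or_desc hx hx' with h | h
  · exact hC.eq_of_depth_le h (by omega)
  · exact (hC.eq_of_depth_le h (by omega)).symm

theorem trichotomy (hC : IsArborescence C r d) (x y : V) :
    ReflTransGen C x y ∨ ReflTransGen C y x ∨
      ∃ v c c', C v c ∧ C v c' ∧ c ≠ c' ∧ ReflTransGen C c x ∧ ReflTransGen C c' y := by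
  induction hC.root_desc x with
  | refl => exact Or.inl (hC.root_desc y)
  | @tail x z _ hxz ih =>
    rcases ih with h | h | ⟨v, c, c', hc, hc', hne, hx, hy⟩
    · rcases h.cases_head with rfl | ⟨c', hc', hy⟩
      · exact Or.inr (Or.inl (.single hxz))
      · by_cases hz : z = c'
        · exact Or.inl (hz ▸ hy)
        · exact Or.inr (Or.inr ⟨x, z, c', hxz, hc', hz, .refl, hy⟩)
    · exact Or.inr (Or.inl (h.tail hxz))
    · exact Or.inr (Or.inr ⟨v, c, c', hc, hc', hne, hx.tail hxz, hy⟩)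

theorem exists_rec (hC : IsArborescence C r d) {β : Type v} (F : V → β → V → β) (b₀ : β) :
    ∃ f : V → β, f r = b₀ ∧ ∀ a c, C a c → f c = F a (f a) c := by
  classical
  let step : ∀ c, (∀ a, d a < d c → β) → β := fun c ih =>
    if h : ∃ a, C a c then F h.choose (ih h.choose (by have := hC.depth h.choose_spec; omega)) c
    else b₀
  refine ⟨(measure d).wf.fix step, ?_, fun a c hac => ?_⟩
  · rw [WellFounded.fix_eq]
    refine dif_neg ?_
    rintro ⟨a, ha⟩
    have := hC.depth ha
    have := hC.depth_le (hC.root_desc a)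
    omega
  · rw [WellFounded.fix_eq]
    have h : ∃ a, C a c := ⟨a, hac⟩
    refine (dif_pos h).trans ?_
    exact congrArg (fun x => F x ((measure d).wf.fix step x) c) (hC.parent_unique h.choose_spec hac)

theorem exists_isPath (hC : IsArborescence C r d)
    {G : SimpleGraph V} (hG : ∀ {a b}, C a b → G.Adj a b) {a b : V}
    (h : ReflTransGen C a b) :
    ∃ w : G.Walk a b, w.IsPath ∧ ∀ x, x ∈ w.support ↔ ReflTransGen C a x ∧ ReflTransGen C x b := by
  induction h with
  | refl =>
    refine ⟨.nil, .nil, fun x => ⟨fun hx => ?_, fun hx => ?_⟩⟩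
    · obtain rfl : x = a := by simpa using hx
      exact ⟨.refl, .refl⟩
    · simpa using hC.antisymm hx.2 hx.1
  | @tail b c hab hbc ih =>
    obtain ⟨w, hw, hsupp⟩ := ih
    refine ⟨w.concat (hG hbc), hw.concat (fun hc => ?_) (hG hbc), fun x => ?_⟩
    · have := hC.depth_le ((hsupp c).1 hc).2
      have := hC.depth hbc
      omega
    · rw [SimpleGraph.Walk.support_concat, List.mem_append, List.mem_singleton, hsupp]
      constructor
      · rintro (hx | rfl)
        · exact ⟨hx.1, hx.2.tail hbc⟩
        · exact ⟨hab.tail hbc, .refl⟩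
      · rintro ⟨hax, hxc⟩
        by_cases h : x = c
        · exact Or.inr h
        · exact Or.inl ⟨hax, hC.desc_tail hxc hbc h⟩

theorem isTree (hC : IsArborescence C r d)
    {G : SimpleGraph V} (hG : ∀ a b, G.Adj a b ↔ C a b ∨ C b a) : G.IsTree := by
  classical
  refine ⟨?_, fun v c hc => ?_⟩
  · have hr : ∀ v, G.Reachable r v := fun v => by
      obtain ⟨w, -⟩ := hC.exists_isPath (fun h => (hG _ _).2 (Or.inl h)) (hC.root_desc v)
      exact ⟨w⟩
    have : Nonempty V := ⟨r⟩
    exact ⟨fun a b => (hr a).symm.trans (hr b)⟩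
  · obtain ⟨x, hx, hmax⟩ := c.support.toFinset.exists_max_image d ⟨v, by simp⟩
    rw [List.mem_toFinset] at hx
    have hparent : ∀ y ∈ (c.rotate x hx).support, G.Adj x y → C y x := by
      intro y hy hxy
      have hy : y ∈ c.support := by simpa using hy
      refine ((hG _ _).1 hxy).resolve_left fun h => ?_
      have := hC.depth h
      have := hmax y (List.mem_toFinset.2 hy)
      omega
    have hc' := hc.rotate hx
    refine hc'.snd_ne_penultimate (hC.parent_unique
      (hparent _ (SimpleGraph.Walk.getVert_mem_support _ _) (SimpleGraph.Walk.adj_snd hc'.not_nil))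
      (hparent _ (SimpleGraph.Walk.getVert_mem_support _ _)
        (SimpleGraph.Walk.adj_penultimate hc'.not_nil).symm))

theorem treeLE_iff (hC : IsArborescence C r d)
    {G : SimpleGraph V} (hG : ∀ a b, G.Adj a b ↔ C a b ∨ C b a) {a b : V} :
    treeLE G r a b ↔ ReflTransGen C a b := by
  obtain ⟨p, hp, hsupp⟩ := hC.exists_isPath (fun h => (hG _ _).2 (Or.inl h)) (hC.root_desc b)
  refine ⟨?_, fun h => ⟨p, hp, (hsupp a).2 ⟨hC.root_desc a, h⟩⟩⟩
  rintro ⟨w, hw, ha⟩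
  obtain rfl : w = p := congrArg Subtype.val
    (((hC.isTree hG).isAcyclic.subsingleton_path _ _).elim ⟨w, hw⟩ ⟨p, hp⟩)
  exact ((hsupp a).1 ha).2

end IsArborescence

/-- The child relation of a rooted graph. -/
def RootedGraph.Child {V : Type u} (T : RootedGraph V) (a b : V) : Prop :=
  T.graph.Adj a b ∧ treeLE T.graph T.root a b

theorem RootedGraph.exists_isArborescence {V : Type u} {T : RootedGraph V}
    (hT : T.graph.IsTree) :
    (∃ d, IsArborescence T.Child T.root d) ∧ (∀ a b, T.graph.Adj a b ↔ T.Child a b ∨ T.Child b a) ∧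
      ∀ a b, treeLE T.graph T.root a b ↔ ReflTransGen T.Child a b := by
  classical
  choose p hp using fun v => (hT.existsUnique_path T.root v).exists
  have huniq : ∀ v (w : T.graph.Walk T.root v), w.IsPath → w = p v := fun v w hw =>
    congrArg Subtype.val ((hT.isAcyclic.subsingleton_path _ _).elim ⟨w, hw⟩ ⟨p v, hp v⟩)
  have hle : ∀ a b, treeLE T.graph T.root a b ↔ a ∈ (p b).support := by
    refine fun a b => ⟨?_, fun h => ⟨p b, hp b, h⟩⟩
    rintro ⟨w, hw, ha⟩
    exact huniq b w hw ▸ ha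
  have hconcat : ∀ {a b} (h : T.Child a b), p b = (p a).concat h.1 := by
    intro a b h
    have hb := (hle a b).1 h.2
    have hb' := SimpleGraph.Walk.endpoint_notMem_support_takeUntil (hp b) hb h.1.ne'
    rw [huniq a _ ((hp b).takeUntil hb)] at hb'
    exact (huniq b _ ((hp a).concat hb' h.1)).symm
  have hadj : ∀ a b, T.graph.Adj a b ↔ T.Child a b ∨ T.Child b a := by
    refine fun a b => ⟨fun h => ?_, ?_⟩
    · by_cases ha : a ∈ (p b).support
      · exact Or.inl ⟨h, (hle a b).2 ha⟩
      · refine Or.inr ⟨h.symm, (hle b a).2 ?_⟩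
        rw [← huniq a _ ((hp b).concat ha h.symm), SimpleGraph.Walk.support_concat]
        simp
    · rintro (h | h)
      exacts [h.1, h.1.symm]
  have hdepth : ∀ {a b}, T.Child a b → (p b).length = (p a).length + 1 := by
    intro a b h
    rw [hconcat h, SimpleGraph.Walk.length_concat]
  have hparent : ∀ v, v ≠ T.root → ∃ u, T.Child u v := fun v hv =>
    ⟨(p v).penultimate, SimpleGraph.Walk.adj_penultimate (SimpleGraph.Walk.not_nil_of_ne hv.symm),
      (hle _ _).2 (SimpleGraph.Walk.getVert_mem_support _ _)⟩
  have hsupp : ∀ n v, (p v).length = n → ∀ a ∈ (p v).support, ReflTransGen T.Child a v := by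
    intro n
    induction n with
    | zero =>
      intro v hv a ha
      by_cases hvr : v = T.root
      · subst hvr
        rw [← huniq _ .nil .nil] at ha
        obtain rfl : a = T.root := by simpa using ha
        exact .refl
      · obtain ⟨u, hu⟩ := hparent v hvr
        have := hdepth hu
        omega
    | succ n ih =>
      intro v hv a ha
      by_cases hvr : v = T.root
      · subst hvr
        rw [← huniq _ .nil .nil] at hv
        simp at hv
      · obtain ⟨u, hu⟩ := hparent v hvr
        rw [hconcat hu, SimpleGraph.Walk.support_concat, List.mem_append, List.mem_singleton] at ha
        rcases ha with ha | rfl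
        · have := hdepth hu
          exact (ih u (by omega) a ha).tail hu
        · exact .refl
  refine ⟨⟨fun v => (p v).length, hdepth, fun {a b c} ha hb => ?_, fun v =>
    hsupp _ v rfl _ (p v).start_mem_support⟩, hadj, fun a b => ⟨fun h =>
    hsupp _ b rfl a ((hle a b).1 h), fun h => (hle a b).2 ?_⟩⟩
  · have := congrArg SimpleGraph.Walk.penultimate ((hconcat ha).symm.trans (hconcat hb))
    simpa using this
  · induction h with
    | refl => exact (p a).end_mem_support
    | tail _ h ih =>
      rw [hconcat h, SimpleGraph.Walk.support_concat]
      exact List.mem_append_left _ ih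

end Arborescence

section Bridge
open Relation Cardinal

theorem RootedLE.of_simulation {V : Type u} {W : Type v} {T : RootedGraph V} {S : RootedGraph W}
    (hT : T.graph.IsTree) (hS : S.graph.IsTree) (R : V → W → Prop) (hroot : R T.root S.root)
    (hR : ∀ v w, R v w → ∃ w', ReflTransGen S.Child w w' ∧ ∃ e : V → W,
      (∀ c, T.Child v c → S.Child w' (e c) ∧ R c (e c)) ∧ Set.InjOn e {c | T.Child v c}) :
    RootedLE T S := by
  classical
  obtain ⟨⟨d, hC⟩, hadj, hle⟩ := RootedGraph.exists_isArborescence hT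
  obtain ⟨⟨d', hC'⟩, hadj', hle'⟩ := RootedGraph.exists_isArborescence hS
  have : Nonempty W := ⟨S.root⟩
  choose! φ' hφ' e he hinj using hR
  obtain ⟨base, hbase₀, hbase⟩ := hC.exists_rec (fun a w c => e a w c) S.root
  have hRb : ∀ v, R v (base v) := by
    intro v
    induction hC.root_desc v with
    | refl => exact hbase₀ ▸ hroot
    | tail _ h ih => exact hbase _ _ h ▸ (he _ _ ih _ h).2
  let φ : V → W := fun v => φ' v (base v)
  have hφ : ∀ v, ReflTransGen S.Child (base v) (φ v) := fun v => hφ' v _ (hRb v)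
  have hchild : ∀ {v c}, T.Child v c → S.Child (φ v) (base c) := fun {v c} h =>
    hbase _ _ h ▸ (he v _ (hRb v) c h).1
  have hsib : ∀ {v c c'}, T.Child v c → T.Child v c' → base c = base c' → c = c' := by
    intro v c c' h h' heq
    rw [hbase _ _ h, hbase _ _ h'] at heq
    exact hinj v _ (hRb v) h h' heq
  have hchild' : ∀ {v c}, T.Child v c → ReflTransGen S.Child (φ v) (φ c) := fun h =>
    (ReflTransGen.single (hchild h)).trans (hφ _)
  have hmono : ∀ {x y}, ReflTransGen T.Child x y → ReflTransGen S.Child (φ x) (φ y) := by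
    intro x y h
    induction h with
    | refl => exact .refl
    | tail _ h ih => exact ih.trans (hchild' h)
  have hbmono : ∀ {x y}, ReflTransGen T.Child x y → ReflTransGen S.Child (base x) (φ y) :=
    fun h => (hφ _).trans (hmono h)
  have hbranch : ∀ {v c c' x y z}, T.Child v c → T.Child v c' → c ≠ c' →
      ReflTransGen T.Child c x → ReflTransGen T.Child c' y →
      ReflTransGen S.Child (φ x) z → ¬ ReflTransGen S.Child (φ y) z := by
    intro v c c' x y z hc hc' hne hx hy hxz hyz
    exact hne (hsib hc hc' (hC'.eq_of_siblings (hchild hc) (hchild hc')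
      ((hbmono hx).trans hxz) ((hbmono hy).trans hyz)))
  have hstrict : ∀ {x y}, ReflTransGen T.Child x y → φ x = φ y → x = y := by
    intro x y h heq
    rcases h.cases_head with h | ⟨c, hc, hcy⟩
    · exact h
    · have h₁ := hC'.depth (hchild hc)
      have h₂ := hC'.depth_le (hbmono hcy)
      rw [heq] at h₁
      omega
  have hφinj : Function.Injective φ := by
    intro x y heq
    rcases hC.trichotomy x y with h | h | ⟨v, c, c', hc, hc', hne, hx, hy⟩
    · exact hstrict h heq
    · exact (hstrict h heq.symm).symm
    · exact (hbranch hc hc' hne hx hy .refl (heq ▸ .refl)).elim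
  have hrefl : ∀ {x y}, ReflTransGen S.Child (φ x) (φ y) → ReflTransGen T.Child x y := by
    intro x y h
    rcases hC.trichotomy x y with h' | h' | ⟨v, c, c', hc, hc', hne, hx, hy⟩
    · exact h'
    · exact hφinj (hC'.antisymm h (hmono h')) ▸ .refl
    · exact (hbranch hc hc' hne hx hy h .refl).elim
  have havoid : ∀ {a b x}, T.Child a b → ReflTransGen S.Child (φ a) (φ x) →
      ReflTransGen S.Child (φ x) (φ b) → φ x = φ a ∨ φ x = φ b := by
    intro a b x hab hax hxb
    rcases hC.eq_or_eq_of_between hab (hrefl hax) (hrefl hxb) with h | h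
    exacts [Or.inl (congrArg φ h), Or.inr (congrArg φ h)]
  have hdisj : ∀ {a b a' b' w}, T.Child a b → T.Child a' b' → s(a, b) ≠ s(a', b') →
      ReflTransGen S.Child (φ a) w → ReflTransGen S.Child w (φ b) →
      ReflTransGen S.Child (φ a') w → ReflTransGen S.Child w (φ b') → w = φ a ∨ w = φ b := by
    intro a b a' b' w hab hab' hne haw hwb haw' hwb'
    by_contra! hw
    have hbw : ReflTransGen S.Child (base b) w := by
      rcases hC'.desc_or_desc (hφ b) hwb with h | h
      · exact h
      · rcases hC'.eq_or_eq_of_between (hchild hab) haw h with h | h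
        exacts [(hw.1 h).elim, h ▸ .refl]
    have hbb : b ≠ b' := by
      rintro rfl
      exact hne (by rw [hC.parent_unique hab hab'])
    rcases hC.trichotomy b b' with h | h | ⟨v, c, c', hc, hc', hne', hx, hy⟩
    · exact hw.2 (hC'.antisymm hwb ((hmono (hC.desc_tail h hab' hbb)).trans haw'))
    · exact hw.1 (hC'.antisymm (hwb'.trans (hmono (hC.desc_tail h hab hbb.symm))) haw)
    · have hcw : ReflTransGen S.Child (base c) (φ b') := by
        have : ReflTransGen S.Child (base c) (base b) := by
          rcases hx.cases_tail with rfl | ⟨y, hy, hyb⟩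
          · exact .refl
          · rw [hC.parent_unique hyb hab] at hy
            exact (hbmono hy).tail (hchild hab)
        exact (this.trans hbw).trans hwb'
      exact hne' (hsib hc hc' (hC'.eq_of_siblings (hchild hc) (hchild hc') hcw (hbmono hy)))
  have hnot : ∀ {a b}, T.Child a b → ¬ T.Child b a := by
    intro a b h h'
    have := hC.depth h
    have := hC.depth h'
    omega
  choose p hp hsupp using fun {a b : W} (h : ReflTransGen S.Child a b) =>
    hC'.exists_isPath (G := S.graph) (fun h => h.1) h
  let path : ∀ ⦃a b : V⦄, T.graph.Adj a b → S.graph.Walk (φ a) (φ b) := fun a b h =>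
    if hab : T.Child a b then p (hchild' hab)
    else (p (hchild' (((hadj a b).1 h).resolve_left hab))).reverse
  have hpath₁ : ∀ {a b} (h : T.graph.Adj a b) (hab : T.Child a b), path h = p (hchild' hab) :=
    fun h hab => dif_pos hab
  have hpath₂ : ∀ {a b} (h : T.graph.Adj a b) (hba : T.Child b a),
      path h = (p (hchild' hba)).reverse := fun h hba => dif_neg (hnot hba)
  have hsupp' : ∀ {a b} (h : T.graph.Adj a b) {w}, w ∈ (path h).support →
      ∃ x y, T.Child x y ∧ s(a, b) = s(x, y) ∧ (∀ u, (u = φ x ∨ u = φ y) ↔ (u = φ a ∨ u = φ b)) ∧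
        ReflTransGen S.Child (φ x) w ∧ ReflTransGen S.Child w (φ y) := by
    intro a b h w hw
    rcases (hadj a b).1 h with hab | hba
    · rw [hpath₁ h hab] at hw
      exact ⟨a, b, hab, rfl, fun _ => Iff.rfl, (hsupp _ w).1 hw⟩
    · rw [hpath₂ h hba, SimpleGraph.Walk.support_reverse, List.mem_reverse] at hw
      exact ⟨b, a, hba, Sym2.eq_swap, fun _ => or_comm, (hsupp _ w).1 hw⟩
  refine ⟨⟨φ, hφinj, path, fun a b h => ?_, fun a b h => ?_, fun a b h w hw hwa hwb x hx => ?_,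
    fun a b a' b' h h' hne w hw hw' => ?_⟩, fun x y h => ?_⟩
  · rcases (hadj a b).1 h with hab | hba
    · rw [hpath₁ h hab]
      exact hp _
    · rw [hpath₂ h hba]
      exact (hp _).reverse
  · rcases (hadj a b).1 h with hab | hba
    · rw [hpath₁ h hab, hpath₂ h.symm hab]
    · rw [hpath₂ h hba, hpath₁ h.symm hba, SimpleGraph.Walk.reverse_reverse]
  · obtain ⟨y, z, hyz, -, hiff, hyw, hwz⟩ := hsupp' h hw
    subst hx
    rcases (hiff _).1 (havoid hyz hyw hwz) with h | h
    exacts [hwa h, hwb h]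
  · obtain ⟨y, z, hyz, heq, hiff, hyw, hwz⟩ := hsupp' h hw
    obtain ⟨y', z', hyz', heq', -, hyw', hwz'⟩ := hsupp' h' hw'
    exact (hiff w).1 (hdisj hyz hyz' (heq ▸ heq' ▸ hne) hyw hwz hyw' hwz')
  · exact (hle' _ _).2 (hmono ((hle x y).1 h))

variable (V : Type u)

/-- The children of a vertex of a tree, where vertices of different trees are told apart. -/
def treeChildren (x : {T : RootedGraph V // T.graph.IsTree} × V) :
    Set ({T : RootedGraph V // T.graph.IsTree} × V) :=
  {y | y.1 = x.1 ∧ x.1.1.Child x.2 y.2}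

variable {V}

theorem desc_treeChildren {x y : {T : RootedGraph V // T.graph.IsTree} × V}
    (h : Desc (treeChildren V) x y) : y.1 = x.1 ∧ ReflTransGen x.1.1.Child x.2 y.2 := by
  induction h with
  | refl => exact ⟨rfl, .refl⟩
  | tail _ h ih => exact ⟨h.1.trans ih.1, ih.2.tail (ih.1 ▸ h.2)⟩

theorem mk_desc_treeChildren_le (x : {T : RootedGraph V // T.graph.IsTree} × V) :
    #{y // Desc (treeChildren V) x y} ≤ #V :=
  Cardinal.mk_le_of_injective (f := fun y : {y // Desc (treeChildren V) x y} => y.1.2)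
    fun y z h => Subtype.ext (Prod.ext
      ((desc_treeChildren y.2).1.trans (desc_treeChildren z.2).1.symm) h)

theorem RootedLE.of_tle {T S : {T : RootedGraph V // T.graph.IsTree}}
    (h : TLE (treeChildren V) (T, T.1.root) (S, S.1.root)) : RootedLE T.1 S.1 := by
  classical
  refine RootedLE.of_simulation T.2 S.2 (fun v w => TLE (treeChildren V) (T, v) (S, w)) h ?_
  intro v w hvw
  obtain ⟨⟨S', w'⟩, hw', e, he, hle⟩ := hvw.step
  obtain ⟨rfl : S' = S, hww'⟩ := desc_treeChildren hw'
  have hmem : ∀ c, T.1.Child v c → (T, c) ∈ treeChildren V (T, v) := fun c hc => ⟨rfl, hc⟩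
  refine ⟨w', hww', fun c => if hc : T.1.Child v c then (e ⟨_, hmem c hc⟩).1.2 else w, ?_, ?_⟩
  · intro c hc
    beta_reduce
    rw [dif_pos hc]
    have h₁ := (e ⟨_, hmem c hc⟩).2
    refine ⟨h₁.2, ?_⟩
    have h₂ := hle ⟨_, hmem c hc⟩
    have h₃ : (e ⟨_, hmem c hc⟩ : {T : RootedGraph V // T.graph.IsTree} × V) =
        (S', (e ⟨_, hmem c hc⟩).1.2) := Prod.ext h₁.1 rfl
    rwa [h₃] at h₂
  · intro c hc c' hc' heq
    have hc : T.1.Child v c := hc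
    have hc' : T.1.Child v c' := hc'
    beta_reduce at heq
    rw [dif_pos hc, dif_pos hc'] at heq
    have := he (Subtype.ext (Prod.ext
      ((e ⟨_, hmem c hc⟩).2.1.trans (e ⟨_, hmem c' hc'⟩).2.1.symm) heq))
    exact congrArg (fun z => z.1.2) this

theorem mk_quot_rootedEquiv_le (V : Type u) [Infinite V] :
    #(Quot fun T S : {T : RootedGraph V // T.graph.IsTree} => RootedEquiv T.1 S.1) ≤
      Order.succ #V := by
  obtain ⟨g, hg⟩ := exists_code_tle (K := V) (mk_desc_treeChildren_le (V := V))
  refine (Cardinal.mk_le_of_injective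
    (f := fun q => g (q.out, q.out.1.root)) fun q q' h => ?_).trans ?_
  · rw [← q.out_eq, ← q'.out_eq]
    exact Quot.sound ⟨.of_tle (hg _ _ h), .of_tle (hg _ _ h.symm)⟩
  · have h : ℵ₀ ≤ Order.succ #V := (aleph0_le_mk V).trans (Order.le_succ _)
    rw [mk_prod, lift_id, lift_id, mk_ord_toType]
    exact (mul_le_mul_right (Order.le_succ _) _).trans (mul_eq_self h).le

end Bridge

section LowerBound
open Relation Cardinal

/-- The last element of a decreasing sequence of elements of `α`, which is the head of the list,
and `α` for the empty sequence. -/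
noncomputable def seqVal {α : Ordinal.{u}} : List α.ToType → Ordinal.{u}
  | [] => α
  | a :: _ => (Ordinal.ToType.mk.symm a).1

theorem seqVal_lt {α : Ordinal.{u}} {a : α.ToType} {l : List α.ToType}
    (h : (a :: l).Pairwise (· < ·)) : seqVal (a :: l) < seqVal l := by
  cases l with
  | nil => exact (Ordinal.ToType.mk.symm a).2
  | cons b l =>
    have hab : a < b := List.rel_of_pairwise_cons h (by simp)
    exact Ordinal.ToType.mk.symm.strictMono hab

theorem exists_cons_of_lt_seqVal {α γ : Ordinal.{u}} {l : List α.ToType}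
    (hl : l.Pairwise (· < ·)) (h : γ < seqVal l) :
    ∃ a, (a :: l).Pairwise (· < ·) ∧ seqVal (a :: l) = γ := by
  cases l with
  | nil =>
    exact ⟨Ordinal.ToType.mk ⟨γ, h⟩, List.pairwise_singleton _ _, by simp [seqVal]⟩
  | cons b l =>
    have hγ : γ < α := h.trans (Ordinal.ToType.mk.symm b).2
    refine ⟨Ordinal.ToType.mk ⟨γ, hγ⟩, ?_, by simp [seqVal]⟩
    have hb : Ordinal.ToType.mk ⟨γ, hγ⟩ < b := by
      rw [← Ordinal.ToType.mk.apply_symm_apply b, OrderIso.lt_iff_lt]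
      exact h
    refine List.pairwise_cons.2 ⟨fun c hc => ?_, hl⟩
    rcases List.mem_cons.1 hc with rfl | hc
    · exact hb
    · exact hb.trans (List.rel_of_pairwise_cons hl hc)

theorem exists_tree_of_ordinal {V : Type u} [Infinite V] {α : Ordinal.{u}} (hα : α.card = #V) :
    ∃ T : RootedGraph V, T.graph.IsTree ∧ ∃ val : V → Ordinal.{u}, val T.root = α ∧
      (∀ x, val x ≤ α) ∧ (∀ x y, treeLE T.graph T.root x y → x ≠ y → val y < val x) ∧
      ∀ x, ∀ γ < val x, ∃ y, treeLE T.graph T.root x y ∧ x ≠ y ∧ val y = γ := by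
  obtain ⟨e⟩ : Nonempty (V ≃ {l : List α.ToType // l.Pairwise (· < ·)}) := by
    have hinf : Infinite α.ToType := by
      rw [infinite_iff, mk_toType, hα]
      exact aleph0_le_mk V
    refine Cardinal.eq.1 (le_antisymm ?_ ?_)
    · rw [← hα, ← mk_toType]
      exact mk_le_of_injective (f := fun a => ⟨[a], List.pairwise_singleton _ _⟩)
        fun a b h => by simpa using h
    · rw [← hα, ← mk_toType, ← mk_list_eq_mk α.ToType]
      exact mk_subtype_le _
  let C : V → V → Prop := fun x y => ∃ a, (e y).1 = a :: (e x).1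
  have hC : IsArborescence C (e.symm ⟨[], List.Pairwise.nil⟩) fun x => (e x).1.length := by
    refine ⟨?_, ?_, ?_⟩
    · rintro x y ⟨a, h⟩
      rw [h, List.length_cons]
    · rintro x y z ⟨a, h⟩ ⟨b, h'⟩
      exact e.injective (Subtype.ext (List.cons.inj (h.symm.trans h')).2)
    · suffices H : ∀ (l : List α.ToType) (hl : l.Pairwise (· < ·)),
          ReflTransGen C (e.symm ⟨[], List.Pairwise.nil⟩) (e.symm ⟨l, hl⟩) from
        fun v => by simpa using H (e v).1 (e v).2
      intro l
      induction l with
      | nil => exact fun _ => .refl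
      | cons a l ih => exact fun hl => (ih hl.of_cons).tail ⟨a, by simp⟩
  let T : RootedGraph V := ⟨SimpleGraph.fromRel C, e.symm ⟨[], List.Pairwise.nil⟩⟩
  have hT : ∀ a b, T.graph.Adj a b ↔ C a b ∨ C b a := by
    refine fun a b => ⟨fun h => h.2, fun h => ⟨?_, h⟩⟩
    rintro rfl
    have := hC.depth (or_self_iff.1 h)
    omega
  have hstep : ∀ {x y}, C x y → seqVal (e y).1 < seqVal (e x).1 := by
    rintro x y ⟨a, h⟩
    have hy := (e y).2
    rw [h] at hy ⊢
    exact seqVal_lt hy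
  have hlt : ∀ {x y}, ReflTransGen C x y → x ≠ y → seqVal (e y).1 < seqVal (e x).1 := by
    intro x y h hne
    rw [reflTransGen_iff_eq_or_transGen] at h
    replace h := h.resolve_left hne.symm
    induction h with
    | single h => exact hstep h
    | @tail y z _ hyz ih =>
      by_cases hxy : x = y
      · exact hxy ▸ hstep hyz
      · exact (hstep hyz).trans (ih hxy)
  have hroot : seqVal (e T.root).1 = α := by simp [T, seqVal]
  refine ⟨T, hC.isTree hT, fun x => seqVal (e x).1, hroot, fun x => ?_,
    fun x y h hne => hlt ((hC.treeLE_iff hT).1 h) hne, fun x γ hγ => ?_⟩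
  · by_cases hx : T.root = x
    · exact (hx ▸ hroot).le
    · exact (hlt (hC.root_desc x) hx).le.trans_eq hroot
  · obtain ⟨a, ha, haγ⟩ := exists_cons_of_lt_seqVal (e x).2 hγ
    have hxy : C x (e.symm ⟨_, ha⟩) := ⟨a, by simp⟩
    refine ⟨e.symm ⟨_, ha⟩, (hC.treeLE_iff hT).2 (.single hxy), ?_, by simpa using haγ⟩
    rintro h
    have := hC.depth hxy
    rw [← h] at this
    omega

/-- There is a map from the vertices of `T` to those of `S` preserving the strict tree-orders. -/
def StrictTreeMap {V : Type u} {W : Type v} (T : RootedGraph V) (S : RootedGraph W) : Prop :=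
  ∃ ψ : V → W, ∀ x y, treeLE T.graph T.root x y → x ≠ y →
    treeLE S.graph S.root (ψ x) (ψ y) ∧ ψ x ≠ ψ y

theorem StrictTreeMap.trans_rootedLE {V W X : Type*} {T : RootedGraph V} {S : RootedGraph W}
    {R : RootedGraph X} (h : StrictTreeMap T S) (h' : RootedLE S R) : StrictTreeMap T R := by
  obtain ⟨ψ, hψ⟩ := h
  obtain ⟨e, he⟩ := h'
  exact ⟨e.toFun ∘ ψ, fun x y hxy hne =>
    ⟨he _ _ (hψ x y hxy hne).1, e.inj.ne (hψ x y hxy hne).2⟩⟩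

theorem succ_le_mk_quot_rootedEquiv (V : Type u) [Infinite V] : Order.succ #V ≤
    #(Quot fun T S : {T : RootedGraph V // T.graph.IsTree} => RootedEquiv T.1 S.1) := by
  have hcard : ∀ γ : (Order.succ #V).ord.ToType,
      ((#V).ord + (Ordinal.ToType.mk.symm γ).1).card = #V := by
    intro γ
    have h : (Ordinal.ToType.mk.symm γ).1 < (Order.succ #V).ord := (Ordinal.ToType.mk.symm γ).2
    rw [Ordinal.card_add, card_ord]
    exact add_eq_left (aleph0_le_mk V) (Order.lt_succ_iff.1 (lt_ord.1 h))
  choose T hT val hroot hle hlt hex using fun γ => exists_tree_of_ordinal (hcard γ)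
  have hmap : ∀ γ δ, StrictTreeMap (T γ) (T δ) → γ ≤ δ := by
    rintro γ δ ⟨ψ, hψ⟩
    have key : ∀ β x, val γ x = β → β ≤ val δ (ψ x) := by
      intro β
      induction β using WellFoundedLT.induction with
      | _ β ih =>
        rintro x rfl
        refine le_of_forall_lt fun ε hε => ?_
        obtain ⟨y, hxy, hne, rfl⟩ := hex γ x ε hε
        exact (ih _ hε y rfl).trans_lt (hlt δ _ _ (hψ x y hxy hne).1 (hψ x y hxy hne).2)
    have := (key _ _ (hroot γ)).trans (hle δ _)
    rw [add_le_add_iff_left] at this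
    exact Ordinal.ToType.mk.symm.le_iff_le.1 this
  let P (γ) : (Quot fun T S : {T : RootedGraph V // T.graph.IsTree} => RootedEquiv T.1 S.1) →
      Prop := Quot.lift (fun S => StrictTreeMap (T γ) S.1)
    fun S R h => propext ⟨fun hS => hS.trans_rootedLE h.1, fun hR => hR.trans_rootedLE h.2⟩
  have hP : ∀ γ δ, Quot.mk _ ⟨T γ, hT γ⟩ =
      Quot.mk (fun T S : {T : RootedGraph V // T.graph.IsTree} => RootedEquiv T.1 S.1)
        ⟨T δ, hT δ⟩ → γ ≤ δ := by
    intro γ δ h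
    have : P γ (Quot.mk _ ⟨T γ, hT γ⟩) := ⟨id, fun x y h hne => ⟨h, hne⟩⟩
    rw [h] at this
    exact hmap γ δ this
  rw [← mk_ord_toType (Order.succ #V)]
  exact mk_le_of_injective (f := fun γ => Quot.mk _ ⟨T γ, hT γ⟩) fun γ δ h =>
    le_antisymm (hP γ δ h) (hP δ γ h.symm)

end LowerBound

/-- For every infinite cardinal `κ`, if `V` is a type of cardinality `κ`, then the quotient
of the set of rooted trees with vertex set `V` by the equivalence relation `≡`
(order-preserving mutual topological embeddability) has cardinality exactly `κ⁺`. -/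
theorem number_of_topological_types_of_rooted_trees (κ : Cardinal.{u})
    (hκ : Cardinal.aleph0 ≤ κ) (V : Type u) (hV : Cardinal.mk V = κ) :
    Cardinal.mk (Quot fun T S : {T : RootedGraph V // T.graph.IsTree} =>
      RootedEquiv T.1 S.1) = Order.succ κ := by
  subst hV
  have : Infinite V := Cardinal.infinite_iff.2 hκ
  exact le_antisymm (mk_quot_rootedEquiv_le V) (succ_le_mk_quot_rootedEquiv V)
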